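/- arXiv:2208.07040 — 3 statements merged into one kernel-verified Lean document; each statement's English description precedes it below -/
import Mathlib

section
/- For every set A ⊆ ℝ of positive Lebesgue outer measure, there exists a set B ⊆ A such that the distance between any two distinct points of B is irrational, and B has the same Lebesgue outer measure as A. -/
open MeasureTheory

/-- A set avoiding rational distances: distances between distinct points are irrational. -/
def ARD (B : Set ℝ) : Prop := ∀ x ∈ B, ∀ y ∈ B, x ≠ y → Irrational |x - y|

namespace GS
open Set Filter

/-- `B` is full in `A`: every measurable set meeting `B` in a null set meets `A` in a null set. -/
def Full (ν : Measure ℝ) (B A : Set ℝ) : Prop :=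
  ∀ E, MeasurableSet E → ν (B ∩ E) = 0 → ν (A ∩ E) = 0

/-- measurable hull -/
abbrev Hh (ν : Measure ℝ) (Z : Set ℝ) : Set ℝ := toMeasurable ν Z

lemma mHh (ν : Measure ℝ) (Z : Set ℝ) : MeasurableSet (Hh ν Z) := measurableSet_toMeasurable _ _

lemma subHh (ν : Measure ℝ) (Z : Set ℝ) : Z ⊆ Hh ν Z := subset_toMeasurable _ _

lemma hull_inter (ν : Measure ℝ) [IsFiniteMeasure ν] (Z E : Set ℝ) (hE : MeasurableSet E) :
    ν (Hh ν Z ∩ E) = ν (Z ∩ E) :=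
  Measure.measure_toMeasurable_inter hE (measure_ne_top _ _)

lemma lemU (ν : Measure ℝ) [IsFiniteMeasure ν] {J : Type*} [Countable J] (A : Set ℝ)
    (F : J → Set ℝ) (h : A ⊆ ⋃ j, F j) : ν (Hh ν A \ ⋃ j, Hh ν (F j)) = 0 := by
  rw [diff_eq, hull_inter ν _ _ (MeasurableSet.iUnion fun j => mHh ν _).compl]
  rw [show A ∩ (⋃ j, Hh ν (F j))ᶜ = ∅ from ?_]; · simp
  rw [← diff_eq, diff_eq_empty]
  exact h.trans (iUnion_mono fun j => subHh _ _)

lemma lemU_ae (ν : Measure ℝ) [IsFiniteMeasure ν] {J : Type*} [Countable J] (A : Set ℝ)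
    (F : J → Set ℝ) (h : A ⊆ ⋃ j, F j) : ∀ᵐ x ∂ν, x ∈ Hh ν A → ∃ j, x ∈ Hh ν (F j) := by
  have := lemU ν A F h
  rw [measure_eq_zero_iff_ae_notMem] at this
  filter_upwards [this] with x hx hxA
  by_contra hc
  exact hx ⟨hxA, by simpa using hc⟩

lemma Full.trans {ν : Measure ℝ} {A B C : Set ℝ} (h : Full ν A B) (h' : Full ν B C) :
    Full ν A C := fun E hE h0 => h' E hE (h E hE h0)

lemma Full.rfl {ν : Measure ℝ} {A : Set ℝ} : Full ν A A := fun _ _ h => h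

theorem lemA (ν : Measure ℝ) [IsFiniteMeasure ν] {ι : Type*} [LinearOrder ι] (X : Set ℝ)
    (ρ : ℝ → ι) (ha : ∀ β, ν {x | x ∈ X ∧ ρ x ≤ β} = 0) :
    ∃ v : ℕ → Set ι, ∀ Z ⊆ X, ∀ Ψ : ℕ → Set ℝ, (∀ i, MeasurableSet (Ψ i)) →
      (∀ i, ∀ x ∈ Z, (ρ x ∈ v i ↔ x ∈ Ψ i)) → ν Z = 0 := by
  obtain ⟨b, hbne, hbas⟩ := TopologicalSpace.exists_countable_basis ℝ |>.imp fun b h => And.intro h.1 h.2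
  obtain ⟨hb0, hbas⟩ := hbas
  have hne : b.Nonempty := by
    by_contra hc
    rw [not_nonempty_iff_eq_empty] at hc
    have := hbas.sUnion_eq
    rw [hc] at this
    simp at this
    exact absurd this.symm (univ_nonempty.ne_empty)
  obtain ⟨B, hB⟩ := hbne.exists_eq_range hne
  have hBo : ∀ i, IsOpen (B i) := fun i => hbas.isOpen (by rw [hB]; exact mem_range_self i)
  have hO : ∀ β : ι, ∀ k : ℕ, ∃ U ⊇ {x | x ∈ X ∧ ρ x ≤ β}, IsOpen U ∧ ν U < ((k:ENNReal)+1)⁻¹ := by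
    intro β k
    apply Set.exists_isOpen_lt_of_lt
    rw [ha β]
    simp
  choose O hOs hOo hOl using hO
  refine ⟨fun n => {β | B (Nat.unpair n).2 ⊆ O β (Nat.unpair n).1}, ?_⟩
  intro Z hZ Ψ hΨ hv
  have hv' : ∀ k i, ∀ x ∈ Z, (B i ⊆ O (ρ x) k ↔ x ∈ Ψ (Nat.pair k i)) := by
    intro k i x hx
    have := hv (Nat.pair k i) x hx
    simpa using this
  set D : Set (ℝ × ℝ) := ⋂ k, ⋃ i, Ψ (Nat.pair k i) ×ˢ B i with hD
  have hDm : MeasurableSet D := MeasurableSet.iInter fun k => MeasurableSet.iUnion fun i =>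
    (hΨ _).prod (hBo i).measurableSet
  have hDx : ∀ x ∈ Z, ∀ y, (x, y) ∈ D ↔ ∀ k, y ∈ O (ρ x) k := by
    intro x hx y
    simp only [hD, mem_iInter, mem_iUnion, mem_prod]
    refine forall_congr' fun k => ⟨?_, ?_⟩
    · rintro ⟨i, h1, h2⟩
      exact (hv' k i x hx).2 h1 h2
    · intro hy
      obtain ⟨u, hu, hyu, huO⟩ := hbas.exists_subset_of_mem_open hy (hOo (ρ x) k)
      rw [hB] at hu
      obtain ⟨i, rfl⟩ := hu
      exact ⟨i, (hv' k i x hx).1 huO, hyu⟩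
  set P : Set ℝ := {x | ν (Prod.mk x ⁻¹' D) = 0} with hP
  have hPm : MeasurableSet P := (measurable_measure_prodMk_left hDm) (measurableSet_singleton 0)
  have hZP : Z ⊆ P := by
    intro x hx
    have hle : ∀ k : ℕ, ν (Prod.mk x ⁻¹' D) ≤ ((k:ENNReal)+1)⁻¹ := by
      intro k
      refine le_trans (measure_mono ?_) (hOl (ρ x) k).le
      intro y hy
      exact (hDx x hx y).1 hy k
    have ht : Tendsto (fun k : ℕ => ((k:ENNReal)+1)⁻¹) atTop (nhds 0) := by
      have := (tendsto_add_atTop_iff_nat 1).2 ENNReal.tendsto_inv_nat_nhds_zero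
      simpa using this
    exact le_antisymm (ge_of_tendsto' ht hle) bot_le
  have hD' : MeasurableSet (D ∩ P ×ˢ univ) := hDm.inter (hPm.prod MeasurableSet.univ)
  have h0 : (ν.prod ν) (D ∩ P ×ˢ univ) = 0 := by
    rw [Measure.measure_prod_null hD']
    refine Filter.Eventually.of_forall fun x => ?_
    by_cases hx : x ∈ P
    · refine measure_mono_null ?_ hx
      intro y hy
      exact hy.1
    · have : Prod.mk x ⁻¹' (D ∩ P ×ˢ univ) = ∅ := by
        ext y; simp [hx]
      simp [this]
  rw [← Measure.prod_swap, Measure.map_apply measurable_swap hD',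
    Measure.measure_prod_null (measurable_swap hD')] at h0
  by_contra hZ0
  have hall : ∀ y ∈ Z, ν (Prod.mk y ⁻¹' (Prod.swap ⁻¹' (D ∩ P ×ˢ univ))) ≠ 0 := by
    intro y hy hn
    apply hZ0
    refine measure_mono_null ?_ (measure_union_null (ha (ρ y)) hn)
    intro x hx
    rcases le_total (ρ x) (ρ y) with h | h
    · exact Or.inl ⟨hZ hx, h⟩
    · right
      refine ⟨?_, hZP hx, mem_univ _⟩
      refine (hDx x hx y).2 fun k => hOs _ _ ⟨hZ hy, h⟩
  apply hZ0
  refine measure_mono_null ?_ (ae_iff.1 h0)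
  intro y hy
  exact hall y hy
end GS

namespace GS
open Set Filter

theorem lemB (ν : Measure ℝ) [IsFiniteMeasure ν] (X : Set ℝ) (w : ℕ → Set ℝ)
    (hw : ∀ Z ⊆ X, ∀ Ψ : ℕ → Set ℝ, (∀ i, MeasurableSet (Ψ i)) →
      (∀ i, ∀ x ∈ Z, (x ∈ w i ↔ x ∈ Ψ i)) → ν Z = 0) (Z : Set ℝ) (hZ : Z ⊆ X) :
    ∀ᵐ x ∂ν, x ∈ Hh ν Z → ∃ i, x ∈ Hh ν (Z ∩ w i) ∧ x ∈ Hh ν (Z \ w i) := by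
  set E : Set ℝ := (⋃ i, (Hh ν (Z ∩ w i) ∩ Hh ν (Z \ w i)))ᶜ with hE
  have hEm : MeasurableSet E :=
    (MeasurableSet.iUnion fun i => (mHh _ _).inter (mHh _ _)).compl
  have h0 : ν (Hh ν Z ∩ E) = 0 := by
    rw [hull_inter ν Z E hEm]
    refine hw _ (inter_subset_left.trans hZ) (fun i => Hh ν (Z ∩ w i)) (fun i => mHh _ _) ?_
    rintro i x ⟨hxZ, hxE⟩
    constructor
    · intro h
      exact subHh _ _ ⟨hxZ, h⟩
    · intro h
      by_contra hc
      apply hxE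
      exact mem_iUnion.2 ⟨i, h, subHh _ _ ⟨hxZ, hc⟩⟩
  rw [measure_eq_zero_iff_ae_notMem] at h0
  filter_upwards [h0] with x hx hxZ
  by_contra hc
  apply hx
  refine ⟨hxZ, ?_⟩
  intro h
  exact hc (by simpa using h)

lemma tree (T : ∀ M, Finset (Fin M → Bool)) (h0 : (T 0).Nonempty)
    (h2 : ∀ M M' (h : M ≤ M'), ∀ t ∈ T M, ∃ t' ∈ T M', t' ∘ Fin.castLE h = t)
    (h3 : ∀ M, ∀ t ∈ T M, ∃ M', ∃ h : M ≤ M', ∃ t' ∈ T M', ∃ t'' ∈ T M', t' ≠ t'' ∧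
      t' ∘ Fin.castLE h = t ∧ t'' ∘ Fin.castLE h = t) (K : ℕ) :
    ∃ M0, ∀ M ≥ M0, K ≤ (T M).card := by
  classical
  have hmono : ∀ M M', M ≤ M' → (T M).card ≤ (T M').card := by
    intro M M' h
    have : T M ⊆ (T M').image (fun t' => t' ∘ Fin.castLE h) := by
      intro t ht
      obtain ⟨t', ht', e⟩ := h2 M M' h t ht
      exact Finset.mem_image.2 ⟨t', ht', e⟩
    exact (Finset.card_le_card this).trans Finset.card_image_le
  induction K with
  | zero => exact ⟨0, fun _ _ => Nat.zero_le _⟩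
  | succ K ih =>
    obtain ⟨M0, hM0⟩ := ih
    obtain ⟨t0, ht0⟩ := h0
    obtain ⟨t, ht, -⟩ := h2 0 M0 (Nat.zero_le _) t0 ht0
    obtain ⟨M', h, t', ht', t'', ht'', hne, e1, e2⟩ := h3 M0 t ht
    refine ⟨M', fun M hM => le_trans ?_ (hmono _ _ hM)⟩
    have hsub : T M0 ⊆ ((T M').erase t').image (fun t' => t' ∘ Fin.castLE h) := by
      intro s hs
      by_cases hst : s = t
      · subst hst
        exact Finset.mem_image.2 ⟨t'', Finset.mem_erase.2 ⟨hne.symm, ht''⟩, e2⟩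
      · obtain ⟨s', hs', e⟩ := h2 M0 M' h s hs
        refine Finset.mem_image.2 ⟨s', Finset.mem_erase.2 ⟨?_, hs'⟩, e⟩
        rintro rfl
        exact hst (e.symm.trans e1)
    have h1 := (Finset.card_le_card hsub).trans Finset.card_image_le
    rw [Finset.card_erase_of_mem ht'] at h1
    have h4 := hM0 M0 le_rfl
    have h5 : 0 < (T M').card := Finset.card_pos.2 ⟨t', ht'⟩
    omega

open Classical in
lemma count {F : Type*} [Fintype F] [DecidableEq F] (T : Finset F) (hT : T.Nonempty) (K : ℕ) (hK : K ≤ T.card) :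
    (Finset.univ.filter (fun χ : F → Bool => ∀ s ∈ T, ∀ t ∈ T, χ s = χ t)).card * 2 ^ K
      ≤ 2 * Fintype.card (F → Bool) := by
  obtain ⟨t0, ht0⟩ := hT
  have h1 : Fintype.card ({χ : F → Bool // ∀ s ∈ T, ∀ t ∈ T, χ s = χ t} × (T → Bool))
      ≤ Fintype.card (Bool × (F → Bool)) := by
    refine Fintype.card_le_of_injective
      (fun p => (p.1.1 t0, fun t => if h : t ∈ T then p.2 ⟨t, h⟩ else p.1.1 t)) ?_
    rintro ⟨⟨χ, hχ⟩, g⟩ ⟨⟨χ', hχ'⟩, g'⟩ h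
    simp only [Prod.mk.injEq] at h
    obtain ⟨ha, hb⟩ := h
    have hg : g = g' := by
      funext ⟨t, ht⟩
      have := congrFun hb t
      simpa [ht] using this
    have hc : χ = χ' := by
      funext t
      by_cases ht : t ∈ T
      · rw [hχ t ht t0 ht0, hχ' t ht t0 ht0, ha]
      · have := congrFun hb t
        simpa [ht] using this
    subst hg; subst hc; rfl
  rw [Fintype.card_prod, Fintype.card_prod, Fintype.card_subtype, Fintype.card_bool] at h1
  refine le_trans (Nat.mul_le_mul_left _ ?_) h1
  rw [Fintype.card_fun, Fintype.card_bool, Fintype.card_coe]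
  exact Nat.pow_le_pow_right (by norm_num) hK

lemma countE {F : Type*} [Fintype F] [DecidableEq F] (T : Finset F) (K : ℕ) (hK : 1 ≤ K) :
    ∑ χ : F → Bool, {T : Finset F | K ≤ T.card ∧ ∀ s ∈ T, ∀ t ∈ T, χ s = χ t}.indicator
      (1 : Finset F → ENNReal) T ≤ 2 * (Fintype.card (F → Bool) : ℕ) / 2 ^ K := by
  classical
  rw [ENNReal.le_div_iff_mul_le (by simp) (by simp)]
  by_cases hk : K ≤ T.card
  · have := count T (Finset.card_pos.1 (by omega)) K hk
    have h2 : ∑ χ : F → Bool, {T : Finset F | K ≤ T.card ∧ ∀ s ∈ T, ∀ t ∈ T, χ s = χ t}.indicator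
      (1 : Finset F → ENNReal) T = ((Finset.univ.filter
        (fun χ : F → Bool => ∀ s ∈ T, ∀ t ∈ T, χ s = χ t)).card : ℕ) := by
      rw [← Finset.sum_boole]
      refine Finset.sum_congr rfl fun χ _ => ?_
      rw [Set.indicator_apply]
      simp only [mem_ofPred_eq, hk, true_and, Pi.one_apply]
    rw [h2]
    exact_mod_cast this
  · have h2 : ∑ χ : F → Bool, {T : Finset F | K ≤ T.card ∧ ∀ s ∈ T, ∀ t ∈ T, χ s = χ t}.indicator
      (1 : Finset F → ENNReal) T = 0 := by
      refine Finset.sum_eq_zero fun χ _ => ?_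
      rw [Set.indicator_apply, if_neg]
      exact fun h => hk h.1
    rw [h2]; simp

open Classical in
/-- bit pattern -/
noncomputable def pt (w : ℕ → Set ℝ) (M : ℕ) (x : ℝ) : Fin M → Bool := fun i => decide (x ∈ w i)

open Classical in
/-- the level `M` patterns that are locally present at `x` -/
noncomputable def TT (ν : Measure ℝ) (w : ℕ → Set ℝ) (Z : Set ℝ) (M : ℕ) (x : ℝ) :
    Finset (Fin M → Bool) :=
  Finset.univ.filter (fun t => x ∈ Hh ν (Z ∩ {y | pt w M y = t}))

lemma mem_TT {ν : Measure ℝ} {w : ℕ → Set ℝ} {Z : Set ℝ} {M : ℕ} {x : ℝ} {t} :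
    t ∈ TT ν w Z M x ↔ x ∈ Hh ν (Z ∩ {y | pt w M y = t}) := by
  simp [TT]

theorem lemC (ν : Measure ℝ) [IsFiniteMeasure ν] (X : Set ℝ) (w : ℕ → Set ℝ)
    (hw : ∀ Z ⊆ X, ∀ Ψ : ℕ → Set ℝ, (∀ i, MeasurableSet (Ψ i)) →
      (∀ i, ∀ x ∈ Z, (x ∈ w i ↔ x ∈ Ψ i)) → ν Z = 0) (Z : Set ℝ) (hZ : Z ⊆ X) :
    ∀ᵐ x ∂ν, x ∈ Hh ν Z → ∀ K, ∃ M0, ∀ M ≥ M0, K ≤ (TT ν w Z M x).card := by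
  have e2 : ∀ᵐ x ∂ν, ∀ M M' (h : M ≤ M') (t : Fin M → Bool), t ∈ TT ν w Z M x →
      ∃ t' ∈ TT ν w Z M' x, t' ∘ Fin.castLE h = t := by
    simp only [ae_all_iff]
    intro M M' h t
    have := lemU_ae ν (Z ∩ {y | pt w M y = t})
      (fun t' : {t' : Fin M' → Bool // t' ∘ Fin.castLE h = t} => Z ∩ {y | pt w M' y = t'.1}) ?_
    · filter_upwards [this] with x hx ht
      obtain ⟨⟨t', h'⟩, hx'⟩ := hx (mem_TT.1 ht)
      exact ⟨t', mem_TT.2 hx', h'⟩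
    · rintro y ⟨hy, hyt⟩
      refine mem_iUnion.2 ⟨⟨pt w M' y, ?_⟩, hy, rfl⟩
      rw [← (hyt : pt w M y = t)]
      rfl
  have e3 : ∀ᵐ x ∂ν, ∀ M (t : Fin M → Bool), t ∈ TT ν w Z M x →
      ∃ i, x ∈ Hh ν ((Z ∩ {y | pt w M y = t}) ∩ w i) ∧
        x ∈ Hh ν ((Z ∩ {y | pt w M y = t}) \ w i) := by
    simp only [ae_all_iff]
    intro M t
    filter_upwards [lemB ν X w hw (Z ∩ {y | pt w M y = t}) (inter_subset_left.trans hZ)] with x hx h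
    exact hx (mem_TT.1 h)
  have e4 : ∀ᵐ x ∂ν, ∀ M M' (h : M ≤ M') (t : Fin M → Bool) (i : Fin M'),
      x ∈ Hh ν ((Z ∩ {y | pt w M y = t}) ∩ w i) →
      ∃ t' ∈ TT ν w Z M' x, t' ∘ Fin.castLE h = t ∧ t' i = true := by
    simp only [ae_all_iff]
    intro M M' h t i
    have := lemU_ae ν ((Z ∩ {y | pt w M y = t}) ∩ w i)
      (fun t' : {t' : Fin M' → Bool // t' ∘ Fin.castLE h = t ∧ t' i = true} =>
        Z ∩ {y | pt w M' y = t'.1}) ?_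
    · filter_upwards [this] with x hx ht
      obtain ⟨⟨t', h'⟩, hx'⟩ := hx ht
      exact ⟨t', mem_TT.2 hx', h'⟩
    · rintro y ⟨⟨hy, hyt⟩, hyw⟩
      refine mem_iUnion.2 ⟨⟨pt w M' y, ?_, ?_⟩, hy, rfl⟩
      · rw [← (hyt : pt w M y = t)]
        rfl
      · simpa [pt] using hyw
  have e5 : ∀ᵐ x ∂ν, ∀ M M' (h : M ≤ M') (t : Fin M → Bool) (i : Fin M'),
      x ∈ Hh ν ((Z ∩ {y | pt w M y = t}) \ w i) →
      ∃ t' ∈ TT ν w Z M' x, t' ∘ Fin.castLE h = t ∧ t' i = false := by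
    simp only [ae_all_iff]
    intro M M' h t i
    have := lemU_ae ν ((Z ∩ {y | pt w M y = t}) \ w i)
      (fun t' : {t' : Fin M' → Bool // t' ∘ Fin.castLE h = t ∧ t' i = false} =>
        Z ∩ {y | pt w M' y = t'.1}) ?_
    · filter_upwards [this] with x hx ht
      obtain ⟨⟨t', h'⟩, hx'⟩ := hx ht
      exact ⟨t', mem_TT.2 hx', h'⟩
    · rintro y ⟨⟨hy, hyt⟩, hyw⟩
      refine mem_iUnion.2 ⟨⟨pt w M' y, ?_, ?_⟩, hy, rfl⟩
      · rw [← (hyt : pt w M y = t)]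
        rfl
      · simpa [pt] using hyw
  have e0 : ∀ᵐ x ∂ν, x ∈ Hh ν Z → (TT ν w Z 0 x).Nonempty := by
    filter_upwards [lemU_ae ν Z (fun t : Fin 0 → Bool => Z ∩ {y | pt w 0 y = t})
      (fun y hy => mem_iUnion.2 ⟨pt w 0 y, hy, rfl⟩)] with x hx hxZ
    obtain ⟨t, ht⟩ := hx hxZ
    exact ⟨t, mem_TT.2 ht⟩
  filter_upwards [e0, e2, e3, e4, e5] with x h0 h2 h3 h4 h5 hxZ
  refine tree (fun M => TT ν w Z M x) (h0 hxZ) h2 ?_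
  intro M t ht
  obtain ⟨i, hi1, hi2⟩ := h3 M t ht
  have hM : M ≤ max M (i+1) := le_max_left _ _
  let i' : Fin (max M (i+1)) := ⟨i, by have := le_max_right M (i+1); omega⟩
  obtain ⟨t', ht', a1, b1⟩ := h4 M _ hM t i' hi1
  obtain ⟨t'', ht'', a2, b2⟩ := h5 M _ hM t i' hi2
  refine ⟨_, hM, t', ht', t'', ht'', ?_, a1, a2⟩
  rintro rfl
  rw [b1] at b2
  exact absurd b2 (by simp)

/-- the region of the hull of `Z` where `A` does not split `Z` -/
def Fail (ν : Measure ℝ) (Z A : Set ℝ) : Set ℝ := Hh ν Z \ (Hh ν (Z ∩ A) ∩ Hh ν (Z \ A))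

lemma mTT (ν : Measure ℝ) (w : ℕ → Set ℝ) (Z : Set ℝ) (M : ℕ)
    (P : Finset (Fin M → Bool) → Prop) : MeasurableSet {x | P (TT ν w Z M x)} := by
  have : {x | P (TT ν w Z M x)} = ⋃ S : {S : Finset (Fin M → Bool) // P S},
      ⋂ t : Fin M → Bool, {x | t ∈ S.1 ↔ x ∈ Hh ν (Z ∩ {y | pt w M y = t})} := by
    ext x
    simp only [mem_ofPred_eq, mem_iUnion, mem_iInter]
    constructor
    · intro h
      exact ⟨⟨_, h⟩, fun t => mem_TT⟩
    · rintro ⟨⟨S, hS⟩, h⟩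
      have : TT ν w Z M x = S := by
        ext t
        rw [mem_TT]
        exact (h t).symm
      rwa [this]
  rw [this]
  refine MeasurableSet.iUnion fun S => MeasurableSet.iInter fun t => ?_
  by_cases ht : t ∈ S.1
  · simpa [ht] using mHh ν _
  · simp only [ht, false_iff]
    exact (mHh ν _).compl
end GS

namespace GS
open Set Filter

theorem lemS1 (ν : Measure ℝ) [IsFiniteMeasure ν] (X : Set ℝ) (w : ℕ → Set ℝ)
    (hw : ∀ Z ⊆ X, ∀ Ψ : ℕ → Set ℝ, (∀ i, MeasurableSet (Ψ i)) →
      (∀ i, ∀ x ∈ Z, (x ∈ w i ↔ x ∈ Ψ i)) → ν Z = 0) (Z : Set ℝ) (hZ : Z ⊆ X)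
    (ε : ENNReal) (hε : ε ≠ 0) :
    ∃ M0, ∀ M ≥ M0, ∑ χ : (Fin M → Bool) → Bool, ν (Fail ν Z {x | χ (pt w M x) = true})
      ≤ ε * Fintype.card ((Fin M → Bool) → Bool) := by
  have hε2 : ε / 2 ≠ 0 := by simp [hε]
  -- choose K
  obtain ⟨K, hK1, hK⟩ : ∃ K : ℕ, 1 ≤ K ∧ 2 * ν univ / 2 ^ K ≤ ε / 2 := by
    have ht : Tendsto (fun K : ℕ => 2 * ν univ / 2 ^ K) atTop (nhds 0) := by
      have h1 : Tendsto (fun K : ℕ => ((2:ENNReal)⁻¹) ^ K) atTop (nhds 0) :=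
        ENNReal.tendsto_pow_atTop_nhds_zero_of_lt_one (by simp)
      have h2 := ENNReal.Tendsto.const_mul (a := 2 * ν univ) h1
        (Or.inr (ENNReal.mul_ne_top (by simp) (measure_ne_top _ _)))
      rw [mul_zero] at h2
      refine h2.congr fun K => ?_
      rw [div_eq_mul_inv, ENNReal.inv_pow]
    have := (ht.eventually_le_const (pos_iff_ne_zero.2 hε2)).and (eventually_ge_atTop 1)
    obtain ⟨K, h1, h2⟩ := this.exists
    exact ⟨K, h2, h1⟩
  set Bad : ℕ → Set ℝ := fun M => Hh ν Z ∩ {x | (TT ν w Z M x).card < K} with hBad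
  have hBadm : ∀ M, MeasurableSet (Bad M) := fun M =>
    (mHh _ _).inter (mTT ν w Z M (fun S => S.card < K))
  have hlim : Tendsto (fun M => ν (⋃ M' : {M' // M ≤ M'}, Bad M'.1)) atTop (nhds 0) := by
    have h0 : ν (⋂ M, ⋃ M' : {M' // M ≤ M'}, Bad M'.1) = 0 := by
      rw [measure_eq_zero_iff_ae_notMem]
      filter_upwards [lemC ν X w hw Z hZ] with x hx hmem
      have hmem' : ∀ M, ∃ M', M ≤ M' ∧ x ∈ Bad M' := by
        intro M
        have := mem_iInter.1 hmem M
        obtain ⟨⟨M', h⟩, hb⟩ := mem_iUnion.1 this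
        exact ⟨M', h, hb⟩
      obtain ⟨_, _, hb⟩ := hmem' 0
      obtain ⟨M0, hM0⟩ := hx hb.1 K
      obtain ⟨M', h, hb'⟩ := hmem' M0
      have := hM0 M' h
      have h2 := hb'.2
      simp only [mem_ofPred_eq] at h2
      omega
    have := tendsto_measure_iInter_atTop (μ := ν) (s := fun M => ⋃ M' : {M' // M ≤ M'}, Bad M'.1)
      (fun M => (MeasurableSet.iUnion fun M' => hBadm _).nullMeasurableSet) ?_ ⟨0, measure_ne_top _ _⟩
    · rwa [h0] at this
    · intro M N hMN
      refine iUnion_subset fun ⟨M', h⟩ => ?_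
      exact subset_iUnion (fun M' : {M' // M ≤ M'} => Bad M'.1) ⟨M', le_trans hMN h⟩
  obtain ⟨M0, hM0⟩ := eventually_atTop.1 (hlim.eventually_le_const (pos_iff_ne_zero.2 hε2))
  refine ⟨M0, fun M hM => ?_⟩
  have hbadM : ν (Bad M) ≤ ε / 2 :=
    (measure_mono (subset_iUnion (fun M' : {M' // M ≤ M'} => Bad M'.1) ⟨M, le_rfl⟩)).trans (hM0 M hM)
  set C : ((Fin M → Bool) → Bool) → Set ℝ := fun χ =>
    {x | K ≤ (TT ν w Z M x).card ∧ ∀ s ∈ TT ν w Z M x, ∀ t ∈ TT ν w Z M x, χ s = χ t} with hC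
  have hCm : ∀ χ, MeasurableSet (C χ) := fun χ =>
    mTT ν w Z M (fun S => K ≤ S.card ∧ ∀ s ∈ S, ∀ t ∈ S, χ s = χ t)
  have hF : ∀ χ, ν (Fail ν Z {x | χ (pt w M x) = true}) ≤ ν (Bad M) + ν (C χ) := by
    intro χ
    refine le_trans ?_ (measure_union_le _ _)
    refine measure_mono_ae ?_
    have m1 : ∀ᵐ x ∂ν, ∀ s : Fin M → Bool, x ∈ Hh ν (Z ∩ {y | pt w M y = s}) →
        (χ s = true → x ∈ Hh ν (Z ∩ {x | χ (pt w M x) = true})) ∧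
        (χ s = false → x ∈ Hh ν (Z \ {x | χ (pt w M x) = true})) := by
      rw [ae_all_iff]
      intro s
      cases hs : χ s
      · filter_upwards [lemU_ae ν (Z ∩ {y | pt w M y = s})
          (fun _ : Unit => (Z \ {x | χ (pt w M x) = true})) (by
            rintro y ⟨hy, hys⟩
            refine mem_iUnion.2 ⟨(), hy, ?_⟩
            have hys : pt w M y = s := hys
            simp [hys, hs])] with x hx h
        obtain ⟨_, h'⟩ := hx h
        exact ⟨by simp, fun _ => h'⟩
      · filter_upwards [lemU_ae ν (Z ∩ {y | pt w M y = s})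
          (fun _ : Unit => (Z ∩ {x | χ (pt w M x) = true})) (by
            rintro y ⟨hy, hys⟩
            refine mem_iUnion.2 ⟨(), hy, ?_⟩
            have hys : pt w M y = s := hys
            simp [hys, hs])] with x hx h
        obtain ⟨_, h'⟩ := hx h
        exact ⟨fun _ => h', by simp⟩
    filter_upwards [m1] with x hx hxF
    obtain ⟨hxZ, hxn⟩ := hxF
    by_cases hc : (TT ν w Z M x).card < K
    · exact Or.inl ⟨hxZ, hc⟩
    · right
      refine ⟨not_lt.1 hc, ?_⟩
      intro s hs t ht
      have hs' := hx s (mem_TT.1 hs)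
      have ht' := hx t (mem_TT.1 ht)
      cases h1 : χ s <;> cases h2 : χ t
      · rfl
      · exact absurd ⟨ht'.1 h2, hs'.2 h1⟩ hxn
      · exact absurd ⟨hs'.1 h1, ht'.2 h2⟩ hxn
      · rfl
  set c : ENNReal := ((Fintype.card ((Fin M → Bool) → Bool) : ℕ) : ENNReal) with hc
  have hsumC : ∑ χ, ν (C χ) ≤ (2 * c / 2 ^ K) * ν univ := by
    have : ∑ χ, ν (C χ) = ∫⁻ x, ∑ χ, (C χ).indicator 1 x ∂ν := by
      rw [lintegral_finsetSum]
      · refine Finset.sum_congr rfl fun χ _ => ?_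
        rw [lintegral_indicator_one (hCm χ)]
      · intro χ _
        exact measurable_one.indicator (hCm χ)
    rw [this, ← lintegral_const]
    refine lintegral_mono fun x => ?_
    have := countE (TT ν w Z M x) K hK1
    exact this
  calc ∑ χ, ν (Fail ν Z {x | χ (pt w M x) = true}) ≤ ∑ χ, (ν (Bad M) + ν (C χ)) :=
        Finset.sum_le_sum fun χ _ => hF χ
    _ = c * ν (Bad M) + ∑ χ, ν (C χ) := by
        rw [Finset.sum_add_distrib, Finset.sum_const, Finset.card_univ, nsmul_eq_mul]
    _ ≤ c * (ε / 2) + (2 * c / 2 ^ K) * ν univ := by gcongr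
    _ = c * (ε / 2) + c * (2 * ν univ / 2 ^ K) := by
        simp only [div_eq_mul_inv]; ring
    _ ≤ c * (ε / 2) + c * (ε / 2) := by gcongr
    _ = ε * c := by rw [← mul_add, ENNReal.add_halves, mul_comm]

theorem lemS (ν : Measure ℝ) [IsFiniteMeasure ν] {ι : Type*} (X : Set ℝ) (ρ : ℝ → ι) (v : ℕ → Set ι)
    (hv : ∀ Z ⊆ X, ∀ Ψ : ℕ → Set ℝ, (∀ i, MeasurableSet (Ψ i)) →
      (∀ i, ∀ x ∈ Z, (ρ x ∈ v i ↔ x ∈ Ψ i)) → ν Z = 0) (N : ℕ) (Z : ℕ → Set ℝ)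
    (hZ : ∀ n, Z n ⊆ X) (ε : ENNReal) (hε : ε ≠ 0) :
    ∃ A : Set ι, ∀ n < N, ν (Fail ν (Z n) (ρ ⁻¹' A)) ≤ ε := by
  classical
  by_cases hεt : ε = ⊤
  · exact ⟨univ, fun n _ => by simp [hεt]⟩
  have hε' : ε / (N + 1 : ℕ) ≠ 0 := by
    rw [Ne, ENNReal.div_eq_zero_iff]
    simp [hε]
  have h1 := fun n => lemS1 ν X (fun i => ρ ⁻¹' v i) hv (Z n) (hZ n) _ hε'
  choose M0 hM0 using h1
  set M := (Finset.range N).sup M0 with hM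
  have hs : ∑ χ : (Fin M → Bool) → Bool, ∑ n ∈ Finset.range N,
      ν (Fail ν (Z n) {x | χ (pt (fun i => ρ ⁻¹' v i) M x) = true})
      ≤ ∑ χ : (Fin M → Bool) → Bool, ε := by
    rw [Finset.sum_comm]
    calc _ ≤ ∑ n ∈ Finset.range N, ε / (N + 1 : ℕ) * Fintype.card ((Fin M → Bool) → Bool) := by
          refine Finset.sum_le_sum fun n hn => hM0 n M ?_
          exact Finset.le_sup (f := M0) hn
      _ = (N * (ε / (N + 1 : ℕ))) * Fintype.card ((Fin M → Bool) → Bool) := by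
          rw [Finset.sum_const, Finset.card_range, nsmul_eq_mul, mul_assoc]
      _ ≤ ε * Fintype.card ((Fin M → Bool) → Bool) := by
          gcongr
          calc (N : ENNReal) * (ε / (N + 1 : ℕ)) ≤ (N + 1 : ℕ) * (ε / (N + 1 : ℕ)) := by
                gcongr; simp
            _ = ε := ENNReal.mul_div_cancel (by simp) (by simp)
      _ = _ := by
          rw [Finset.sum_const, Finset.card_univ, nsmul_eq_mul, mul_comm]
  obtain ⟨χ, hχ⟩ : ∃ χ : (Fin M → Bool) → Bool, ∑ n ∈ Finset.range N,
      ν (Fail ν (Z n) {x | χ (pt (fun i => ρ ⁻¹' v i) M x) = true}) ≤ ε := by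
    by_contra! hc
    exact absurd hs (not_le.2 (ENNReal.sum_lt_sum_of_nonempty Finset.univ_nonempty fun χ _ => hc χ))
  refine ⟨{α | χ (fun i => decide (α ∈ v i)) = true}, fun n hn => ?_⟩
  refine le_trans ?_ hχ
  have := Finset.single_le_sum (f := fun n =>
    ν (Fail ν (Z n) {x | χ (pt (fun i => ρ ⁻¹' v i) M x) = true}))
    (fun _ _ => zero_le) (Finset.mem_range.2 hn)
  refine le_trans (le_of_eq ?_) this
  rfl

theorem lemh (ν : Measure ℝ) [IsFiniteMeasure ν] {ι : Type*} (X : Set ℝ) (ρ : ℝ → ι) (v : ℕ → Set ι)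
    (hv : ∀ Z ⊆ X, ∀ Ψ : ℕ → Set ℝ, (∀ i, MeasurableSet (Ψ i)) →
      (∀ i, ∀ x ∈ Z, (ρ x ∈ v i ↔ x ∈ Ψ i)) → ν Z = 0) (N : ℕ) (Xs : ℕ → Set ℝ)
    (hX : ∀ n, Xs n ⊆ X) (ε : ENNReal) (hε : ε ≠ 0) :
    ∃ h : ι → ℕ, ∀ n < N, ∀ j, ν (Hh ν (Xs n) \ Hh ν (Xs n ∩ {x | h (ρ x) = j})) ≤ ε := by
  classical
  obtain ⟨e, he0, hes⟩ := ENNReal.exists_pos_sum_of_countable' hε ℕ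
  have hg : ∀ (R : Set ι) (j : ℕ), ∃ A : Set ι, ∀ n < N,
      ν (Fail ν (Xs n ∩ ρ ⁻¹' R) (ρ ⁻¹' A)) ≤ e j := fun R j =>
    lemS ν X ρ v hv N (fun n => Xs n ∩ ρ ⁻¹' R) (fun n => inter_subset_left.trans (hX n)) (e j)
      (he0 j).ne'
  choose g hg using hg
  let R : ℕ → Set ι := fun j => Nat.rec (motive := fun _ => Set ι) univ (fun j R => R ∩ g R j) j
  have hR0 : R 0 = univ := rfl
  have hRs : ∀ j, R (j+1) = R j ∩ g (R j) j := fun j => rfl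
  have hRa : Antitone R := antitone_nat_of_succ_le fun j => by rw [hRs]; exact inter_subset_left
  have hb : ∀ n < N, ∀ j, ν (Hh ν (Xs n) \ Hh ν (Xs n ∩ ρ ⁻¹' R j)) ≤ ∑ i ∈ Finset.range j, e i := by
    intro n hn j
    induction j with
    | zero => simp [hR0]
    | succ j ih =>
      rw [Finset.sum_range_succ]
      refine le_trans (le_trans (measure_mono ?_) (measure_union_le _ _)) (add_le_add ih (hg (R j) j n hn))
      rintro x ⟨hx, hx'⟩
      by_cases hxj : x ∈ Hh ν (Xs n ∩ ρ ⁻¹' R j)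
      · refine Or.inr ⟨hxj, fun hc => hx' ?_⟩
        rw [hRs, preimage_inter, ← inter_assoc]
        exact hc.1
      · exact Or.inl ⟨hx, hxj⟩
  let h : ι → ℕ := fun α => if H : ∃ j : ℕ, α ∉ R (j+1) then Nat.find H else 0
  have hh : ∀ α j, α ∈ R j → α ∉ R (j+1) → h α = j := by
    intro α j h1 h2
    have H : ∃ j, α ∉ R (j+1) := ⟨j, h2⟩
    simp only [h, dif_pos H]
    refine (Nat.find_eq_iff H).2 ⟨h2, fun i hi hc => hc (hRa (by omega : i + 1 ≤ j) h1)⟩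
  refine ⟨h, fun n hn j => ?_⟩
  have hfin : ∑ i ∈ Finset.range (j+1), e i ≤ ε := (ENNReal.sum_le_tsum _).trans hes.le
  refine le_trans ?_ hfin
  rw [Finset.sum_range_succ]
  refine le_trans (le_trans (measure_mono_ae ?_) (measure_union_le _ _))
    (add_le_add (hb n hn j) (hg (R j) j n hn))
  filter_upwards [lemU_ae ν ((Xs n ∩ ρ ⁻¹' R j) \ (ρ ⁻¹' g (R j) j))
    (fun _ : Unit => Xs n ∩ {x | h (ρ x) = j}) (by
      rintro y ⟨⟨hy, hy1⟩, hy2⟩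
      refine mem_iUnion.2 ⟨(), hy, hh _ _ hy1 ?_⟩
      rw [hRs]
      exact fun hc => hy2 hc.2)] with x hx hxm
  obtain ⟨h1, h2⟩ := hxm
  by_cases hxj : x ∈ Hh ν (Xs n ∩ ρ ⁻¹' R j)
  · refine Or.inr ⟨hxj, fun hc => h2 ?_⟩
    obtain ⟨_, h'⟩ := hx hc.2
    exact h'
  · exact Or.inl ⟨h1, hxj⟩
end GS

namespace GS
open Set Filter

lemma vol_dyadic (p : ℕ) (z : ℤ) : volume {x : ℝ | ⌊x * 2 ^ p⌋ = z} ≤ (2⁻¹ : ENNReal) ^ p := by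
  have hsub : {x : ℝ | ⌊x * 2 ^ p⌋ = z} ⊆ Ico ((z:ℝ) * (1/2)^p) (((z:ℝ) + 1) * (1/2)^p) := by
    intro x hx
    have hx : ⌊x * 2 ^ p⌋ = z := hx
    rw [Int.floor_eq_iff] at hx
    have h2 : (0:ℝ) < (1/2)^p := by positivity
    have h3 : x = (x * 2 ^ p) * (1/2)^p := by
      rw [mul_assoc, ← mul_pow]; norm_num
    constructor
    · rw [h3]; exact mul_le_mul_of_nonneg_right hx.1 h2.le
    · rw [h3]; exact mul_lt_mul_of_pos_right hx.2 h2
  refine (measure_mono hsub).trans ?_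
  rw [Real.volume_Ico, show ((z:ℝ) + 1) * (1/2)^p - (z:ℝ) * (1/2)^p = (1/2)^p by ring,
    ENNReal.ofReal_pow (by norm_num)]
  refine pow_le_pow_left' ?_ p
  rw [one_div, ENNReal.ofReal_inv_of_pos (by norm_num)]
  simp

theorem roth (ν : Measure ℝ) (hac : ν ≪ volume) (X : Set ℝ) (hX : ν X ≠ 0) {J : Type*}
    (hb : ∀ N : J → Set ℝ, (∀ j, N j ⊆ X) → (∀ j, ν (N j) = 0) → ν (⋃ j, N j) = 0)
    (f : J → ℕ → ℕ) : ∃ b : ℕ → ℕ, ∀ j, ∀ᶠ p in atTop, f j p ≠ b p := by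
  by_contra! hc
  apply hX
  let s : J → ℕ → Set ℝ := fun j p => {x : ℝ | ⌊x * 2 ^ p⌋ = Equiv.intEquivNat.symm (f j p)}
  refine measure_mono_null ?_ (hb (fun j => X ∩ {x | ∃ᶠ p in atTop, x ∈ s j p})
    (fun j => inter_subset_left) fun j => ?_)
  · intro x hx
    obtain ⟨j, hj⟩ := hc (fun p => Equiv.intEquivNat ⌊x * 2 ^ p⌋)
    refine mem_iUnion.2 ⟨j, hx, ?_⟩
    have hj' : ∃ᶠ p in atTop, f j p = Equiv.intEquivNat ⌊x * 2 ^ p⌋ := by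
      simpa [Filter.Frequently] using hj
    refine hj'.mono fun p hp => ?_
    show ⌊x * 2 ^ p⌋ = Equiv.intEquivNat.symm (f j p)
    rw [hp, Equiv.symm_apply_apply]
  · refine measure_mono_null inter_subset_right (hac ?_)
    have hs : ∑' p, volume (s j p) ≠ ⊤ := by
      refine ne_top_of_le_ne_top ?_ (ENNReal.tsum_le_tsum fun p => vol_dyadic p _)
      rw [ENNReal.tsum_geometric]
      simp
    have := ae_eventually_notMem hs
    rw [ae_iff] at this
    simpa [Filter.Frequently] using this

theorem denseFam (ν : Measure ℝ) [IsFiniteMeasure ν] : ∃ q : ℕ → ℝ → ℕ, (∀ i, Measurable (q i)) ∧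
    ∀ w : ℝ → ℕ, Measurable w → ∀ ε : ENNReal, ε ≠ 0 → ∃ i, ν {x | q i x ≠ w x} < ε := by
  have : Fact ((1:ENNReal) ≠ ⊤) := ⟨ENNReal.one_ne_top⟩
  have : Fact ((1:ENNReal) ≤ 1) := ⟨le_rfl⟩
  have : SecondCountableTopology (Lp ℝ 1 ν) := inferInstance
  let d : ℕ → Lp ℝ 1 ν := TopologicalSpace.denseSeq (Lp ℝ 1 ν)
  refine ⟨fun i x => ⌊d i x + 1/2⌋₊, fun i => ?_, ?_⟩
  · exact Nat.measurable_floor.comp ((Lp.stronglyMeasurable (d i)).measurable.add_const _)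
  intro w hw ε hε
  have hε2 : 0 < ε / 2 := by simp [pos_iff_ne_zero, hε]
  -- truncation
  obtain ⟨n, hn⟩ : ∃ n : ℕ, ν {x | n ≤ w x} < ε / 2 := by
    have := tendsto_measure_iInter_atTop (μ := ν) (s := fun n : ℕ => {x | n ≤ w x})
      (fun n => (measurableSet_le measurable_const hw).nullMeasurableSet)
      (fun a b hab x hx => le_trans hab hx) ⟨0, measure_ne_top _ _⟩
    have he : (⋂ n : ℕ, {x | n ≤ w x}) = ∅ := by
      ext x
      simp only [mem_iInter, mem_empty_iff_false, iff_false, not_forall]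
      exact ⟨w x + 1, fun h => Nat.not_succ_le_self (w x) h⟩
    rw [he, measure_empty] at this
    exact (this.eventually_lt_const hε2).exists
  let w' : ℝ → ℝ := fun x => (min (w x) n : ℕ)
  have hw'm : Measurable w' := measurable_from_top.comp (hw.min measurable_const)
  have hmem : MemLp w' 1 ν := by
    refine MemLp.of_bound hw'm.aestronglyMeasurable n (Eventually.of_forall fun x => ?_)
    simp only [w', Real.norm_natCast]
    exact_mod_cast min_le_right _ _
  obtain ⟨δ, hδ0, hδ⟩ : ∃ δ : ENNReal, 0 < δ ∧ 2 * δ < ε / 2 := by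
    by_cases ht : ε = ⊤
    · exact ⟨1, by simp, by simp [ht, ENNReal.top_div]⟩
    · refine ⟨ε / 2 / 2 / 2, ?_, ?_⟩
      · simp [pos_iff_ne_zero, hε]
      · rw [ENNReal.mul_div_cancel (by simp) (by simp)]
        exact ENNReal.half_lt_self hε2.ne' (by simp [ENNReal.div_eq_top, ht])
  obtain ⟨i, hi⟩ := (TopologicalSpace.denseRange_denseSeq (Lp ℝ 1 ν)).exists_mem_open
    (Metric.isOpen_eball (x := hmem.toLp w') (ε := δ)) ⟨_, Metric.mem_eball_self hδ0⟩
  have hi' : edist (d i) (hmem.toLp w') < δ := hi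
  rw [Lp.edist_def] at hi'
  have hmk := meas_ge_le_mul_pow_eLpNorm_enorm ν (p := 1) one_ne_zero ENNReal.one_ne_top
    (f := (⇑(d i) - ⇑(hmem.toLp w')))
    ((Lp.aestronglyMeasurable _).sub (Lp.aestronglyMeasurable _)) (ε := 2⁻¹) (by simp) (by simp)
  refine ⟨i, ?_⟩
  have hle : ν {x | ⌊d i x + 1/2⌋₊ ≠ w x} ≤ ν {x | n ≤ w x} +
      ν {x | (2⁻¹ : ENNReal) ≤ ‖((⇑(d i) - ⇑(hmem.toLp w')) : ℝ → ℝ) x‖ₑ} := by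
    refine le_trans (measure_mono_ae ?_) (measure_union_le _ _)
    filter_upwards [hmem.coeFn_toLp] with x hx hne
    by_cases hnx : n ≤ w x
    · exact Or.inl hnx
    · right
      show (2⁻¹ : ENNReal) ≤ ‖d i x - hmem.toLp w' x‖ₑ
      rw [hx]
      have : w' x = w x := by simp [w']; omega
      rw [this]
      by_contra! hlt
      apply hne
      have h1 : |d i x - w x| < 1/2 := by
        rw [Real.enorm_eq_ofReal_abs, show (2⁻¹ : ENNReal) = ENNReal.ofReal (1/2) by
          rw [one_div, ENNReal.ofReal_inv_of_pos (by norm_num)]; simp] at hlt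
        exact (ENNReal.ofReal_lt_ofReal_iff (by norm_num)).1 hlt
      rw [abs_lt] at h1
      have hpos : (0:ℝ) ≤ w x := by positivity
      rw [Nat.floor_eq_iff (by linarith)]
      constructor <;> linarith
  refine hle.trans_lt ?_
  rw [← ENNReal.add_halves ε]
  refine ENNReal.add_lt_add hn (hmk.trans_lt ?_)
  refine lt_of_le_of_lt ?_ hδ
  simp only [ENNReal.toReal_one, ENNReal.rpow_one, inv_inv]
  gcongr

lemma wsel (F : ℕ → Set ℝ) (hF : ∀ j, MeasurableSet (F j)) :
    ∃ w : ℝ → ℕ, Measurable w ∧ ∀ x, (∃ j, x ∈ F j) → x ∈ F (w x) := by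
  classical
  have h : ∀ x, ∃ n, x ∈ F n ∨ ∀ j, x ∉ F j := by
    intro x
    by_cases hx : ∃ j, x ∈ F j
    · exact hx.imp fun j hj => Or.inl hj
    · push Not at hx
      exact ⟨0, Or.inr hx⟩
  refine ⟨fun x => Nat.find (h x), ?_, ?_⟩
  · refine measurable_find h fun k => ?_
    have : {x | x ∈ F k ∨ ∀ j, x ∉ F j} = F k ∪ ⋂ j, (F j)ᶜ := by
      ext x; simp
    rw [this]
    exact (hF k).union (MeasurableSet.iInter fun j => (hF j).compl)
  · rintro x ⟨j, hj⟩
    rcases Nat.find_spec (h x) with h1 | h1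
    · exact h1
    · exact absurd hj (h1 j)

lemma zero_of_freq (c : ENNReal) (h : ∃ᶠ k : ℕ in atTop, c ≤ (2⁻¹ : ENNReal) ^ k) : c = 0 := by
  by_contra hc
  have h1 : Tendsto (fun K : ℕ => ((2:ENNReal)⁻¹) ^ K) atTop (nhds 0) :=
    ENNReal.tendsto_pow_atTop_nhds_zero_of_lt_one (by simp)
  obtain ⟨k, hk1, hk2⟩ := (h.and_eventually (h1.eventually_lt_const (pos_iff_ne_zero.2 hc))).exists
  exact absurd hk1 (not_le.2 hk2)

end GS

namespace GS
open Set Filter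

theorem core (ν : Measure ℝ) [IsFiniteMeasure ν] (hac : ν ≪ volume) {ι : Type*} [LinearOrder ι]
    (X : Set ℝ) (hX : ν X ≠ 0) (ρ : ℝ → ι) (ha : ∀ β, ν {x | x ∈ X ∧ ρ x ≤ β} = 0)
    (hb : ∀ β : ι, ∀ N : Iio β → Set ℝ, (∀ j, N j ⊆ X) → (∀ j, ν (N j) = 0) → ν (⋃ j, N j) = 0)
    (Xs : ℕ → Set ℝ) (hXs : ∀ n, Xs n ⊆ X)
    (H : ∀ Z ⊆ X, ν Z ≠ 0 → ∃ n E, MeasurableSet E ∧ ν (Xs n ∩ E) ≠ 0 ∧ ν ((Xs n ∩ E) \ Z) = 0) :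
    False := by
  classical
  obtain ⟨v, hv⟩ := lemA ν X ρ ha
  have hh : ∀ k : ℕ, ∃ h : ι → ℕ, ∀ n < k + 1, ∀ j,
      ν (Hh ν (Xs n) \ Hh ν (Xs n ∩ {x | h (ρ x) = j})) ≤ (2⁻¹ : ENNReal) ^ k := fun k =>
    lemh ν X ρ v hv (k+1) Xs hXs _ (by simp)
  choose h hh using hh
  have hii : ∀ b : ℕ → ℕ, ∃ α, ∃ᶠ k in atTop, h k α = b k := by
    intro b
    by_contra! hc
    have hc' : ∀ α, ∃ m, ∀ k ≥ m, h k α ≠ b k := by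
      intro α
      have := hc α
      rw [eventually_atTop] at this
      exact this
    set Xm : ℕ → Set ℝ := fun m => {x | x ∈ X ∧ ∀ k ≥ m, h k (ρ x) ≠ b k} with hXm
    obtain ⟨m, hm⟩ : ∃ m, ν (Xm m) ≠ 0 := by
      by_contra! hn
      refine hX (measure_mono_null ?_ (measure_iUnion_null hn))
      intro x hx
      obtain ⟨m, hm⟩ := hc' (ρ x)
      exact mem_iUnion.2 ⟨m, hx, hm⟩
    obtain ⟨n, E, hE, hne, h0⟩ := H (Xm m) (fun x hx => hx.1) hm
    apply hne
    apply zero_of_freq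
    refine Eventually.frequently ?_
    filter_upwards [eventually_ge_atTop m, eventually_ge_atTop n] with k hkm hkn
    set V := Xs n ∩ {x | h k (ρ x) = b k} with hV
    have h1 : ν (Hh ν V ∩ E) = 0 := by
      rw [hull_inter ν V E hE]
      refine measure_mono_null ?_ h0
      rintro x ⟨⟨hx1, hx2⟩, hxE⟩
      exact ⟨⟨hx1, hxE⟩, fun hx => hx.2 k hkm hx2⟩
    calc ν (Xs n ∩ E) ≤ ν ((Hh ν V ∩ E) ∪ (Hh ν (Xs n) \ Hh ν V)) := by
          refine measure_mono ?_
          rintro x ⟨hx1, hx2⟩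
          by_cases hxV : x ∈ Hh ν V
          · exact Or.inl ⟨hxV, hx2⟩
          · exact Or.inr ⟨subHh _ _ hx1, hxV⟩
      _ ≤ 0 + (2⁻¹ : ENNReal) ^ k :=
          (measure_union_le _ _).trans (add_le_add h1.le (hh k n (by omega) _))
      _ = _ := zero_add _
  obtain ⟨q, hqm, hqd⟩ := denseFam ν
  let L : ℕ → List ℕ := fun k => (Encodable.decode k : Option (List ℕ)).getD []
  let qq : ι → ℕ → ℕ → ℝ → ℕ := fun α k n => q ((L (h k α)).getD n 0)
  have hbx : ∀ x : ℝ, ∃ b : ℕ → ℕ → ℕ, ∀ α < ρ x, ∃ m, ∀ k ≥ m, ∀ n, qq α k n x ≠ b k n := by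
    intro x
    obtain ⟨b, hb'⟩ := roth ν hac X hX (hb (ρ x))
      (fun j p => qq j.1 (Nat.unpair p).1 (Nat.unpair p).2 x)
    refine ⟨fun k n => b (Nat.pair k n), fun α hα => ?_⟩
    obtain ⟨m, hm⟩ := eventually_atTop.1 (hb' ⟨α, hα⟩)
    refine ⟨m, fun k hk n => ?_⟩
    have := hm (Nat.pair k n) (le_trans hk (Nat.left_le_pair k n))
    simpa using this
  choose bx hbx using hbx
  have hw : ∀ k n : ℕ, ∃ w : ℝ → ℕ, Measurable w ∧
      ∀ x, (∃ j, x ∈ Hh ν {x | x ∈ Xs n ∧ bx x k n = j}) →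
        x ∈ Hh ν {y | y ∈ Xs n ∧ bx y k n = w x} := fun k n =>
    wsel (fun j => Hh ν {x | x ∈ Xs n ∧ bx x k n = j}) (fun j => mHh _ _)
  choose w hwm hw using hw
  have hi : ∀ k n : ℕ, ∃ i, ν {x | q i x ≠ w k n x} < (2⁻¹ : ENNReal) ^ k := fun k n =>
    hqd _ (hwm k n) _ (by simp)
  choose i hi using hi
  obtain ⟨α, hα⟩ := hii (fun k => Encodable.encode ((List.range (k+1)).map (i k)))
  set Xm : ℕ → Set ℝ := fun m => {x | x ∈ X ∧ ∀ k ≥ m, ∀ n, qq α k n x ≠ bx x k n} with hXm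
  obtain ⟨m, hm⟩ : ∃ m, ν (Xm m) ≠ 0 := by
    by_contra! hn
    refine hX (measure_mono_null ?_ (measure_union_null (ha α) (measure_iUnion_null hn)))
    intro x hx
    rcases le_or_gt (ρ x) α with h1 | h1
    · exact Or.inl ⟨hx, h1⟩
    · obtain ⟨m, hm⟩ := hbx x α h1
      exact Or.inr (mem_iUnion.2 ⟨m, hx, hm⟩)
  obtain ⟨n, E, hE, hne, h0⟩ := H (Xm m) (fun x hx => hx.1) hm
  apply hne
  apply zero_of_freq
  refine (hα.and_eventually ((eventually_ge_atTop m).and (eventually_ge_atTop n))).mono ?_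
  rintro k ⟨hk, hkm, hkn⟩
  have hqq : qq α k n = q (i k n) := by
    simp only [qq, L, hk, Encodable.encodek, Option.getD_some]
    congr 1
    simp [List.getD_eq_getElem?_getD, Nat.lt_succ_of_le hkn]
  have hnull : ν (⋃ j, (Hh ν {x | x ∈ Xs n ∧ bx x k n = j} ∩
      (E ∩ ({x | w k n x = j} ∩ {x | q (i k n) x = j})))) = 0 := by
    refine measure_iUnion_null fun j => ?_
    rw [hull_inter]
    · refine measure_mono_null ?_ h0
      rintro x ⟨⟨hx1, hx2⟩, hxE, hx3, hx4⟩
      refine ⟨⟨hx1, hxE⟩, fun hx => hx.2 k hkm n ?_⟩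
      rw [hqq, hx2]
      exact hx4
    · exact hE.inter ((hwm k n (measurableSet_singleton j)).inter
        (hqm _ (measurableSet_singleton j)))
  have hcov := lemU_ae ν (Xs n) (fun j => {x | x ∈ Xs n ∧ bx x k n = j})
    (fun x hx => mem_iUnion.2 ⟨bx x k n, hx, rfl⟩)
  calc ν (Xs n ∩ E) ≤ ν ((⋃ j, (Hh ν {x | x ∈ Xs n ∧ bx x k n = j} ∩
      (E ∩ ({x | w k n x = j} ∩ {x | q (i k n) x = j})))) ∪ {x | q (i k n) x ≠ w k n x}) := by
        refine measure_mono_ae ?_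
        filter_upwards [hcov] with x hx hxm
        obtain ⟨hx1, hx2⟩ := hxm
        by_cases hxq : q (i k n) x = w k n x
        · exact Or.inl (mem_iUnion.2 ⟨w k n x, hw k n x (hx (subHh _ _ hx1)), hx2, rfl, hxq⟩)
        · exact Or.inr hxq
    _ ≤ 0 + (2⁻¹ : ENNReal) ^ k := (measure_union_le _ _).trans (add_le_add hnull.le (hi k n).le)
    _ = _ := zero_add _
end GS

namespace GS
open Set Filter

open Cardinal in
theorem core0 (ν : Measure ℝ) [IsFiniteMeasure ν] (hac : ν ≪ volume)
    (X : Set ℝ) (hX : ν X ≠ 0) (Xs : ℕ → Set ℝ)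
    (H : ∀ Z ⊆ X, ν Z ≠ 0 → ∃ n E, MeasurableSet E ∧ ν (Xs n ∩ E) ≠ 0 ∧ ν ((Xs n ∩ E) \ Z) = 0) :
    False := by
  classical
  let S : Set Cardinal.{0} := {c | ∃ N : c.ord.ToType → Set ℝ, (∀ i, N i ⊆ X) ∧
    (∀ i, ν (N i) = 0) ∧ ν (⋃ i, N i) ≠ 0}
  have hSne : S.Nonempty := by
    obtain ⟨e⟩ : Nonempty ((#ℝ).ord.ToType ≃ ℝ) := Cardinal.eq.1 (by simp)
    refine ⟨#ℝ, fun i => X ∩ {e i}, fun i => inter_subset_left, fun i => ?_, ?_⟩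
    · exact measure_mono_null inter_subset_right (hac (by simp))
    · intro h0
      refine hX (measure_mono_null ?_ h0)
      intro x hx
      exact mem_iUnion.2 ⟨e.symm x, hx, by simp⟩
  obtain ⟨κ, hκS, hκmin⟩ : ∃ κ ∈ S, ∀ c ∈ S, κ ≤ c :=
    ⟨sInf S, csInf_mem hSne, fun c hc => csInf_le' hc⟩
  obtain ⟨N, hNX, hN0, hNu⟩ := hκS
  have hsmall : ∀ (J : Type) (F : J → Set ℝ), #J < κ → (∀ j, F j ⊆ X) → (∀ j, ν (F j) = 0) →
      ν (⋃ j, F j) = 0 := by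
    intro J F hJ hFX hF0
    by_contra hne
    obtain ⟨e⟩ : Nonempty ((#J).ord.ToType ≃ J) := Cardinal.eq.1 (by simp)
    have : #J ∈ S := by
      refine ⟨fun i => F (e i), fun i => hFX _, fun i => hF0 _, ?_⟩
      rwa [e.surjective.iUnion_comp F]
    exact absurd (hκmin _ this) (not_le.2 hJ)
  set X' := ⋃ i, N i with hX'
  have hX'X : X' ⊆ X := iUnion_subset hNX
  have hne : Nonempty κ.ord.ToType := by
    by_contra hc
    rw [not_nonempty_iff] at hc
    apply hNu
    rw [hX', iUnion_of_empty, measure_empty]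
  have hρ : ∀ x : ℝ, ∃ i : κ.ord.ToType, x ∈ X' → x ∈ N i := by
    intro x
    by_cases hx : x ∈ X'
    · obtain ⟨i, hi⟩ := mem_iUnion.1 hx
      exact ⟨i, fun _ => hi⟩
    · exact ⟨hne.some, fun h => absurd h hx⟩
  choose ρ hρ using hρ
  refine core ν hac X' hNu ρ ?_ ?_ (fun n => Xs n ∩ X') (fun n => inter_subset_right) ?_
  · intro β
    have h1 := hsmall (Iio β) (fun j => N j.1) (Cardinal.mk_Iio_toType_ord_lt β)
      (fun j => hNX _) (fun j => hN0 _)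
    refine measure_mono_null ?_ (measure_union_null h1 (hN0 β))
    rintro x ⟨hx, hle⟩
    rcases hle.lt_or_eq with h | h
    · exact Or.inl (mem_iUnion.2 ⟨⟨ρ x, h⟩, hρ x hx⟩)
    · right
      rw [← h]
      exact hρ x hx
  · intro β F hF hF0
    exact hsmall _ F (Cardinal.mk_Iio_toType_ord_lt β) (fun j => (hF j).trans hX'X) hF0
  · intro Z hZ hZ0
    obtain ⟨n, E, hE, h1, h2⟩ := H Z (hZ.trans hX'X) hZ0
    refine ⟨n, E, hE, ?_, ?_⟩
    · intro h3
      refine h1 (measure_mono_null ?_ (measure_union_null h3 h2))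
      intro x hx
      by_cases hxZ : x ∈ Z
      · exact Or.inl ⟨⟨hx.1, hZ hxZ⟩, hx.2⟩
      · exact Or.inr ⟨hx, hxZ⟩
    · refine measure_mono_null ?_ h2
      rintro x ⟨⟨⟨a, b⟩, c⟩, d⟩
      exact ⟨⟨a, c⟩, d⟩

theorem lemL (ν : Measure ℝ) [IsFiniteMeasure ν] (hac : ν ≪ volume) (X : Set ℝ)
    (Xs : ℕ → Set ℝ) : ∃ B ⊆ X, Full ν B X ∧ ∀ n, Full ν (Xs n \ B) (Xs n) := by
  let G : Set (Set ℝ) := {B | B ⊆ X ∧ ∀ n, Full ν (Xs n \ B) (Xs n)}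
  have hG0 : (∅ : Set ℝ) ∈ G := ⟨empty_subset _, fun n => by simpa using Full.rfl⟩
  obtain ⟨B, hB, hmax⟩ : ∃ B ∈ G, ∀ B' ∈ G, ν B' ≤ ν B := by
    obtain ⟨u, -, hu, huG⟩ := exists_seq_tendsto_sSup (S := ν '' G) ⟨_, mem_image_of_mem _ hG0⟩
      (OrderTop.bddAbove _)
    choose C hCG hCu using huG
    set D : ℕ → Set ℝ := disjointed (fun k => Hh ν (C k)) with hD
    have hDm : ∀ k, MeasurableSet (D k) := fun k => MeasurableSet.disjointed (fun k => mHh _ _) k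
    have hDd : Pairwise (Function.onFun Disjoint D) := disjoint_disjointed _
    have hDU : ⋃ k, D k = ⋃ k, Hh ν (C k) := iUnion_disjointed
    have hDs : ∀ k, D k ⊆ Hh ν (C k) := disjointed_subset _
    set B : Set ℝ := ⋃ k, (C k ∩ D k) with hBdef
    have hBG : B ∈ G := by
      refine ⟨iUnion_subset fun k => inter_subset_left.trans (hCG k).1, fun n E hE h0 => ?_⟩
      have h1 : ∀ k, ν (Xs n ∩ (E ∩ D k)) = 0 := by
        intro k
        refine (hCG k).2 n _ (hE.inter (hDm k)) (measure_mono_null ?_ h0)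
        rintro x ⟨⟨hx1, hx2⟩, hxE, hxD⟩
        refine ⟨⟨hx1, fun hxB => ?_⟩, hxE⟩
        obtain ⟨j, hj1, hj2⟩ := mem_iUnion.1 hxB
        by_cases hjk : j = k
        · exact hx2 (hjk ▸ hj1)
        · exact disjoint_left.1 (hDd hjk) hj2 hxD
      refine measure_mono_null ?_ (measure_union_null (measure_iUnion_null h1) h0)
      rintro x ⟨hx1, hxE⟩
      by_cases hx : x ∈ B
      · obtain ⟨j, hj1, hj2⟩ := mem_iUnion.1 hx
        exact Or.inl (mem_iUnion.2 ⟨j, hx1, hxE, hj2⟩)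
      · exact Or.inr ⟨⟨hx1, hx⟩, hxE⟩
    refine ⟨B, hBG, fun B' hB' => ?_⟩
    have hsup : sSup (ν '' G) ≤ ν B := by
      refine le_of_tendsto' hu fun k => ?_
      rw [← hCu k]
      have h2 : ∀ j, ν (Hh ν (C j) ∩ (D j \ Hh ν B)) = 0 := by
        intro j
        rw [hull_inter ν _ _ ((hDm j).diff (mHh _ _))]
        refine measure_mono_null ?_ (measure_empty (μ := ν))
        rintro x ⟨hx1, hx2, hx3⟩
        exact hx3 (subHh _ _ (mem_iUnion.2 ⟨j, hx1, hx2⟩))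
      calc ν (C k) ≤ ν (Hh ν B ∪ ⋃ j, (Hh ν (C j) ∩ (D j \ Hh ν B))) := by
            refine measure_mono ?_
            intro x hx
            by_cases hxB : x ∈ Hh ν B
            · exact Or.inl hxB
            · have : x ∈ ⋃ k, D k := by
                rw [hDU]; exact mem_iUnion.2 ⟨k, subHh _ _ hx⟩
              obtain ⟨j, hj⟩ := mem_iUnion.1 this
              exact Or.inr (mem_iUnion.2 ⟨j, hDs j hj, hj, hxB⟩)
        _ ≤ ν (Hh ν B) + 0 := (measure_union_le _ _).trans
            (add_le_add le_rfl (measure_iUnion_null h2).le)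
        _ = ν B := by rw [add_zero, measure_toMeasurable]
    exact (le_sSup (mem_image_of_mem _ hB')).trans hsup
  refine ⟨B, hB.1, ?_, hB.2⟩
  have hnull : ν (X \ Hh ν B) = 0 := by
    by_contra hne
    refine core0 ν hac (X \ Hh ν B) hne Xs fun Z hZ hZ0 => ?_
    by_contra! hc
    have hfull : ∀ n, Full ν (Xs n \ Z) (Xs n) := by
      intro n E hE h0
      by_contra hne
      refine hc n E hE hne (measure_mono_null ?_ h0)
      rintro x ⟨⟨a, b⟩, c⟩
      exact ⟨⟨a, c⟩, b⟩
    have hgood : B ∪ Z ∈ G := by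
      refine ⟨union_subset hB.1 (hZ.trans diff_subset), fun n E hE h0 => ?_⟩
      have h1 : ν (Xs n ∩ (E ∩ Hh ν B)) = 0 := by
        refine hB.2 n _ (hE.inter (mHh _ _)) (measure_mono_null ?_ h0)
        rintro x ⟨⟨a, b⟩, c, d⟩
        exact ⟨⟨a, fun h => h.elim b fun h => (hZ h).2 d⟩, c⟩
      have h2 : ν (Xs n ∩ (E \ Hh ν B)) = 0 := by
        refine hfull n _ (hE.diff (mHh _ _)) (measure_mono_null ?_ h0)
        rintro x ⟨⟨a, b⟩, c, d⟩
        exact ⟨⟨a, fun h => h.elim (fun h => d (subHh _ _ h)) b⟩, c⟩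
      refine measure_mono_null ?_ (measure_union_null h1 h2)
      rintro x ⟨a, b⟩
      by_cases hx : x ∈ Hh ν B
      · exact Or.inl ⟨a, b, hx⟩
      · exact Or.inr ⟨a, b, hx⟩
    have h3 := hmax _ hgood
    rw [← measure_inter_add_diff (B ∪ Z) (mHh ν B)] at h3
    have h4 : ν B + ν Z ≤ ν B := by
      refine le_trans (add_le_add (measure_mono ?_) (measure_mono ?_)) h3
      · exact fun x hx => ⟨Or.inl hx, subHh _ _ hx⟩
      · exact fun x hx => ⟨Or.inr hx, (hZ hx).2⟩
    exact absurd h4 (not_le.2 (ENNReal.lt_add_right (measure_ne_top _ _) hZ0))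
  intro E hE h0
  rw [← hull_inter ν B E hE] at h0
  refine measure_mono_null ?_ (measure_union_null h0 hnull)
  rintro x ⟨a, b⟩
  by_cases hx : x ∈ Hh ν B
  · exact Or.inl ⟨hx, b⟩
  · exact Or.inr ⟨a, hx⟩

theorem refinement (ν : Measure ℝ) [IsFiniteMeasure ν] (hac : ν ≪ volume) (A : ℕ → Set ℝ) :
    ∃ B : ℕ → Set ℝ, (∀ n, B n ⊆ A n) ∧ (∀ m n, ∀ x, x ∈ B m → x ∈ B n → m = n) ∧
      ∀ n, Full ν (B n) (A n) := by
  let P := {U : Set ℝ // ∀ m, Full ν (A m \ U) (A m)}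
  have h : ∀ (n : ℕ) (U : P), ∃ B ⊆ A n \ U.1, Full ν B (A n \ U.1) ∧
      ∀ m, Full ν ((A m \ U.1) \ B) (A m \ U.1) := fun n U => lemL ν hac _ _
  choose g hg1 hg2 hg3 using h
  let nxt : ℕ → P → P := fun n U => ⟨U.1 ∪ g n U, fun m => by
    rw [← diff_diff]
    exact (hg3 n U m).trans (U.2 m)⟩
  let U : ℕ → P := fun n => Nat.rec (motive := fun _ => P)
    ⟨∅, fun m => by simpa using Full.rfl⟩ (fun n U => nxt n U) n
  have hUs : ∀ n, (U (n+1)).1 = (U n).1 ∪ g n (U n) := fun n => rfl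
  have hmono : Monotone (fun n => (U n).1) :=
    monotone_nat_of_le_succ fun n => by rw [hUs]; exact subset_union_left
  have hlt : ∀ m n, m < n → ∀ x, x ∈ g m (U m) → x ∈ g n (U n) → False := by
    intro m n hmn x hm hn
    refine (hg1 n (U n) hn).2 (hmono (Nat.succ_le_of_lt hmn) ?_)
    show x ∈ (U (m+1)).1
    rw [hUs]
    exact Or.inr hm
  refine ⟨fun n => g n (U n), fun n => (hg1 n _).trans diff_subset, ?_, fun n =>
    (hg2 n _).trans ((U n).2 n)⟩
  intro m n x hm hn
  rcases lt_trichotomy m n with h | h | h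
  · exact (hlt m n h x hm hn).elim
  · exact h
  · exact (hlt n m h x hn hm).elim

end GS


/-- rational-difference equivalence -/
def GS.ratSetoid : Setoid ℝ where
  r x y := ∃ q : ℚ, x - y = q
  iseqv := {
    refl := fun x => ⟨0, by simp⟩
    symm := by
      rintro x y ⟨q, hq⟩
      exact ⟨-q, by push_cast; linarith⟩
    trans := by
      rintro x y z ⟨q, hq⟩ ⟨r, hr⟩
      exact ⟨q + r, by push_cast; linarith⟩ }

theorem stmt0 (A : Set ℝ) (hA : 0 < volume A) :
    ∃ B ⊆ A, ARD B ∧ volume B = volume A := by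
  have hν1 : (volume : Measure ℝ).toFinite ≪ volume := toFinite_absolutelyContinuous _
  have hν2 : (volume : Measure ℝ) ≪ volume.toFinite := absolutelyContinuous_toFinite _
  let t : ℝ → ℝ := fun x => (Quotient.mk GS.ratSetoid x).out
  have ht1 : ∀ x, ∃ q : ℚ, x - t x = q := by
    intro x
    have : GS.ratSetoid.r (t x) x := Quotient.exact (Quotient.out_eq (Quotient.mk GS.ratSetoid x))
    exact GS.ratSetoid.symm this
  have ht2 : ∀ x y, (∃ q : ℚ, t x - t y = q) → t x = t y := by
    rintro x y ⟨q, hq⟩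
    obtain ⟨a, ha⟩ := ht1 x
    obtain ⟨b, hb⟩ := ht1 y
    have : Quotient.mk GS.ratSetoid x = Quotient.mk GS.ratSetoid y :=
      Quotient.sound (s := GS.ratSetoid) ⟨a + q - b, by push_cast; linarith⟩
    simp only [t, this]
  let e : ℚ ≃ ℕ := Denumerable.eqv ℚ
  let f : ℕ → ℝ := fun n => (e.symm n : ℝ)
  let An : ℕ → Set ℝ := fun n => {s | s ∈ Set.range t ∧ s + f n ∈ A}
  obtain ⟨Bn, hB1, hB2, hB3⟩ := GS.refinement volume.toFinite hν1 An
  refine ⟨⋃ n, {x | x - f n ∈ Bn n}, ?_, ?_, ?_⟩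
  · refine Set.iUnion_subset fun n x hx => ?_
    have := (hB1 n hx).2
    simpa using this
  · intro x hx y hy hne hrat
    obtain ⟨n, hn⟩ := Set.mem_iUnion.1 hx
    obtain ⟨m, hm⟩ := Set.mem_iUnion.1 hy
    have hn : x - f n ∈ Bn n := hn
    have hm : y - f m ∈ Bn m := hm
    obtain ⟨r, hr⟩ := hrat
    have hxy : ∃ q : ℚ, x - y = q := by
      rcases abs_choice (x - y) with h | h
      · exact ⟨r, by rw [hr, h]⟩
      · exact ⟨-r, by push_cast; rw [hr, h]; ring⟩
    obtain ⟨q, hq⟩ := hxy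
    obtain ⟨a, ha⟩ := (hB1 n hn).1
    obtain ⟨b, hb⟩ := (hB1 m hm).1
    have hab := ht2 a b ⟨q - e.symm n + e.symm m, by
      rw [ha, hb]; push_cast; simp only [f]; linarith⟩
    rw [ha, hb] at hab
    have hnm : n = m := hB2 n m _ hn (hab ▸ hm)
    subst hnm
    exact hne (by linarith)
  · set B : Set ℝ := ⋃ n, {x | x - f n ∈ Bn n} with hB
    have hBA : B ⊆ A := by
      refine Set.iUnion_subset fun n x hx => ?_
      have := (hB1 n hx).2
      simpa using this
    refine le_antisymm (measure_mono hBA) ?_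
    set E : Set ℝ := (toMeasurable volume B)ᶜ with hE
    have hEm : MeasurableSet E := (measurableSet_toMeasurable _ _).compl
    have hAE : volume (A ∩ E) = 0 := by
      have h1 : ∀ n, volume ((fun x => x + -f n) ⁻¹' (An n ∩ ((fun s => s + f n) ⁻¹' E))) = 0 := by
        intro n
        rw [measure_preimage_add_right]
        refine hν2 (hB3 n _ (hEm.preimage (measurable_id.add_const _)) ?_)
        refine measure_mono_null ?_ measure_empty
        rintro s ⟨hs1, hs2⟩
        refine hs2 (subset_toMeasurable _ _ (Set.mem_iUnion.2 ⟨n, ?_⟩))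
        show s + f n - f n ∈ Bn n
        simpa using hs1
      refine measure_mono_null ?_ (measure_iUnion_null h1)
      rintro x ⟨hxA, hxE⟩
      obtain ⟨q, hq⟩ := ht1 x
      refine Set.mem_iUnion.2 ⟨e q, ?_⟩
      have hfq : f (e q) = x - t x := by simp [f, hq]
      have hx' : x + -f (e q) = t x := by rw [hfq]; ring
      show x + -f (e q) ∈ An (e q) ∩ ((fun s => s + f (e q)) ⁻¹' E)
      rw [hx']
      have hx2 : t x + f (e q) = x := by rw [hfq]; ring
      refine ⟨⟨⟨x, rfl⟩, ?_⟩, ?_⟩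
      · rw [hx2]; exact hxA
      · show t x + f (e q) ∈ E
        rw [hx2]; exact hxE
    calc volume A ≤ volume (toMeasurable volume B ∪ (A ∩ E)) := by
          refine measure_mono fun x hx => ?_
          by_cases h : x ∈ toMeasurable volume B
          · exact Or.inl h
          · exact Or.inr ⟨hx, h⟩
      _ ≤ volume (toMeasurable volume B) + volume (A ∩ E) := measure_union_le _ _
      _ = volume B := by rw [hAE, add_zero, measure_toMeasurable]
end

section
/- Every set A ⊆ ℝ of positive Lebesgue outer measure contains an ARD subset B that is full in A, i.e., for every Lebesgue measurable set M, if M ∩ A has positive outer measure then M ∩ B has positive outer measure. -/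
open MeasureTheory

set_option linter.unusedSectionVars false

namespace Refine
open Filter Set

abbrev env (μ : Measure ℝ) (S : Set ℝ) : Set ℝ := toMeasurable μ S

variable {μ : Measure ℝ} [IsFiniteMeasure μ]

lemma env_meas (S : Set ℝ) : MeasurableSet (env μ S) := measurableSet_toMeasurable _ _

lemma env_inter (S : Set ℝ) {E : Set ℝ} (hE : MeasurableSet E) :
    μ (env μ S ∩ E) = μ (S ∩ E) := Measure.measure_toMeasurable_inter_of_sFinite hE S

lemma sub_env (S : Set ℝ) : S ⊆ env μ S := subset_toMeasurable _ _

/-- countable covering, local version -/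
lemma env_cover_local {ι : Type*} [Countable ι] {S E : Set ℝ} (hE : MeasurableSet E)
    (T : ι → Set ℝ) (h : μ ((S ∩ E) \ ⋃ i, T i) = 0) :
    ∀ᵐ x ∂μ, x ∈ E → x ∈ env μ S → ∃ i, x ∈ env μ (T i) := by
  have hm : MeasurableSet (E ∩ (⋃ i, env μ (T i))ᶜ) :=
    hE.inter (MeasurableSet.iUnion fun i => env_meas (T i)).compl
  have h0 : μ (env μ S ∩ (E ∩ (⋃ i, env μ (T i))ᶜ)) = 0 := by
    rw [env_inter S hm]
    refine measure_mono_null ?_ h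
    rintro x ⟨hxS, hxE, hx⟩
    refine ⟨⟨hxS, hxE⟩, fun hx' => hx ?_⟩
    obtain ⟨i, hi⟩ := mem_iUnion.1 hx'
    exact mem_iUnion.2 ⟨i, sub_env _ hi⟩
  rw [ae_iff]
  refine measure_mono_null ?_ h0
  intro x hx
  simp only [mem_ofPred_eq, Classical.not_imp, not_exists] at hx
  refine ⟨hx.2.1, hx.1, ?_⟩
  simpa using hx.2.2

lemma env_cover {ι : Type*} [Countable ι] {S : Set ℝ}
    (T : ι → Set ℝ) (h : S ⊆ ⋃ i, T i) :
    ∀ᵐ x ∂μ, x ∈ env μ S → ∃ i, x ∈ env μ (T i) := by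
  have := env_cover_local (μ := μ) (S := S) MeasurableSet.univ T (by
    rw [inter_univ, sdiff_eq_empty.2 h, measure_empty])
  filter_upwards [this] with x hx using hx trivial

lemma env_mono {S T : Set ℝ} (h : S ⊆ T) :
    ∀ᵐ x ∂μ, x ∈ env μ S → x ∈ env μ T := by
  filter_upwards [env_cover (μ := μ) (S := S) (fun _ : Unit => T) (by rw [iUnion_const]; exact h)] with x hx h1
  obtain ⟨_, h2⟩ := hx h1
  exact h2

lemma env_mono_local {S T E : Set ℝ} (hE : MeasurableSet E) (h : μ ((S ∩ E) \ T) = 0) :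
    ∀ᵐ x ∂μ, x ∈ E → x ∈ env μ S → x ∈ env μ T := by
  filter_upwards [env_cover_local (μ := μ) (S := S) hE (fun _ : Unit => T) (by rw [iUnion_const]; exact h)]
    with x hx h0 h1
  obtain ⟨_, h2⟩ := hx h0 h1
  exact h2

lemma env_pos {ι : Type*} [Countable ι] {S E : Set ℝ} (hE : MeasurableSet E)
    (T : ι → Set ℝ) (h : ∀ᵐ x ∂μ, x ∈ E → x ∈ env μ S → ∃ i, x ∈ env μ (T i))
    (hpos : μ (S ∩ E) ≠ 0) : ∃ i, μ (T i ∩ E) ≠ 0 := by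
  by_contra hc
  push Not at hc
  apply hpos
  rw [← env_inter S hE]
  have h1 : ∀ᵐ x ∂μ, ∀ i, x ∉ env μ (T i) ∩ E := by
    rw [ae_all_iff]
    intro i
    have : μ (env μ (T i) ∩ E) = 0 := by rw [env_inter _ hE, hc i]
    exact measure_eq_zero_iff_ae_notMem.1 this
  refine measure_eq_zero_iff_ae_notMem.2 ?_
  filter_upwards [h, h1] with x hx hx1 hx2
  obtain ⟨i, hi⟩ := hx hx2.2 hx2.1
  exact hx1 i ⟨hi, hx2.2⟩

/-- random reals do not add unbounded functions -/
lemma rb (D : ℕ → Set ℝ) (hD : ∀ m, MeasurableSet (D m)) (P : ℕ → ℕ → ℕ → Set ℝ)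
    (hP : ∀ m k J, MeasurableSet (P m k J))
    (h : ∀ m k, ∀ᵐ x ∂μ, x ∈ D m → ∃ J, x ∈ P m k J) :
    ∃ g : ℕ → ℕ, ∀ᵐ x ∂μ, ∀ m, x ∈ D m → ∀ᶠ k in atTop, ∃ J ≤ g k, x ∈ P m k J := by
  let R : ℕ → ℕ → Set ℝ := fun k N => ⋃ m ∈ Finset.range (k+1), (D m ∩ ⋂ J ∈ Finset.range (N+1), (P m k J)ᶜ)
  have hRm : ∀ k N, MeasurableSet (R k N) := fun k N =>
    Finset.measurableSet_biUnion _ fun m _ => (hD m).inter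
      (Finset.measurableSet_biInter _ fun J _ => (hP m k J).compl)
  have hR : ∀ k, ∃ N, μ (R k N) ≤ (1/2 : ENNReal)^k := by
    intro k
    have hanti : Antitone (R k) := by
      intro N N' hN x hx
      simp only [R, mem_iUnion, Finset.mem_range, mem_inter_iff, mem_iInter] at hx ⊢
      obtain ⟨m, hm, h1, h2⟩ := hx
      exact ⟨m, hm, h1, fun J hJ => h2 J (by omega)⟩
    have hz : μ (⋂ N, R k N) = 0 := by
      have hall : ∀ᵐ x ∂μ, ∀ m, x ∈ D m → ∃ J, x ∈ P m k J := ae_all_iff.2 fun m => h m k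
      refine measure_eq_zero_iff_ae_notMem.2 ?_
      filter_upwards [hall] with x hx hx2
      have hbd : ∃ N, ∀ m ∈ Finset.range (k+1), x ∈ D m → ∃ J ≤ N, x ∈ P m k J := by
        choose! J hJ using hx
        refine ⟨(Finset.range (k+1)).sup J, fun m hm hxm => ⟨J m, Finset.le_sup hm, hJ m hxm⟩⟩
      obtain ⟨N, hN⟩ := hbd
      have := mem_iInter.1 hx2 N
      simp only [R, mem_iUnion, mem_inter_iff, mem_iInter] at this
      obtain ⟨m, hm, h1, h2⟩ := this
      obtain ⟨J, hJ, hJx⟩ := hN m hm h1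
      exact h2 J (by simp; omega) hJx
    have ht := tendsto_measure_iInter_atTop (μ := μ) (fun N => (hRm k N).nullMeasurableSet) hanti
      ⟨0, measure_ne_top _ _⟩
    rw [hz] at ht
    have : ∀ᶠ N in atTop, μ (R k N) < (1/2 : ENNReal)^k :=
      ht.eventually_lt_const (ENNReal.pow_pos (by simp) k)
    obtain ⟨N, hN⟩ := this.exists
    exact ⟨N, hN.le⟩
  choose g hg using hR
  refine ⟨g, ?_⟩
  have hs : ∑' k, μ (R k (g k)) ≠ ⊤ := by
    refine ne_top_of_le_ne_top ?_ (ENNReal.tsum_le_tsum hg)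
    rw [ENNReal.tsum_geometric]
    simp
  filter_upwards [ae_eventually_notMem hs] with x hx m hxm
  filter_upwards [hx, eventually_ge_atTop m] with k hk hmk
  by_contra hc
  push Not at hc
  apply hk
  simp only [R, mem_iUnion, mem_inter_iff, mem_iInter]
  exact ⟨m, by simp; omega, hxm, fun J hJ => hc J (by simp at hJ; omega)⟩

lemma lusin {X : Set ℝ} (O : ℝ → Set ℝ) (I : ℕ → Set ℝ) (ε : ENNReal)
    (hε : ε < μ X)
    (hI : ∀ i, MeasurableSet (I i))
    (hO : ∀ y, ∀ x ∈ O y, ∃ i, x ∈ I i ∧ I i ⊆ O y)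
    (hOμ : ∀ y, μ (O y) ≤ ε)
    (hX : ∀ x ∈ X, ∀ᵐ y ∂μ, y ∈ X → x ∈ O y)
    (s : ℝ → ℕ → Bool) (hs : ∀ y i, s y i = true ↔ I i ⊆ O y)
    {Y : Set ℝ} (hY : Y ⊆ X) :
    ∀ᵐ x ∂μ, x ∈ env μ Y → ∃ i, ∀ b, x ∈ env μ (Y ∩ {y | s y i = b}) := by
  let P : ℕ → Set ℝ := fun i => env μ (Y ∩ {y | s y i = true})
  let E : Set ℝ := env μ Y \ ⋃ i, ⋂ b, env μ (Y ∩ {y | s y i = b})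
  have hEm : MeasurableSet E := (env_meas Y).diff
    (MeasurableSet.iUnion fun i => MeasurableSet.iInter fun b => env_meas _)
  by_contra hcon
  have hE0 : μ E ≠ 0 := by
    intro h0
    apply hcon
    filter_upwards [measure_eq_zero_iff_ae_notMem.1 h0] with x hx hxY
    by_contra hc
    apply hx
    refine ⟨hxY, fun hx' => hc ?_⟩
    simpa using hx'
  have hsP : ∀ y ∈ Y ∩ E, ∀ i, y ∈ P i ↔ I i ⊆ O y := by
    rintro y ⟨hyY, hyE⟩ i
    rw [← hs]
    constructor
    · intro hyP
      by_contra hne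
      have hf : s y i = false := by simpa using hne
      apply hyE.2
      refine mem_iUnion.2 ⟨i, mem_iInter.2 fun b => ?_⟩
      cases b
      · exact sub_env _ ⟨hyY, hf⟩
      · exact hyP
    · intro h
      exact sub_env _ ⟨hyY, h⟩
  let R : Set (ℝ × ℝ) := ⋃ i, (I i ×ˢ P i)
  have hRm : MeasurableSet R := MeasurableSet.iUnion fun i => (hI i).prod (env_meas _)
  have hsec : ∀ y ∈ Y ∩ E, (fun x => (x, y)) ⁻¹' R = O y := by
    intro y hy
    ext x
    simp only [R, mem_preimage, mem_iUnion, mem_prod]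
    constructor
    · rintro ⟨i, hx, hyi⟩
      exact (hsP y hy i).1 hyi hx
    · intro hx
      obtain ⟨i, h1, h2⟩ := hO y x hx
      exact ⟨i, h1, (hsP y hy i).2 h2⟩
  let E2 : Set ℝ := E ∩ {x | μ ((fun x' => (x', x)) ⁻¹' R) ≤ ε}
  have hE2m : MeasurableSet E2 :=
    hEm.inter (measurableSet_le (measurable_measure_prodMk_right hRm) measurable_const)
  have hYE2 : Y ∩ E ⊆ E2 := fun y hy => ⟨hy.2, by
    change μ _ ≤ ε
    rw [hsec y hy]; exact hOμ y⟩
  have hE2Y : E2 ⊆ env μ Y := fun x hx => hx.1.1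
  have hE20 : μ E2 ≠ 0 := by
    intro h0
    apply hE0
    have : E = env μ Y ∩ E := (inter_eq_right.2 (fun x hx => hx.1)).symm
    rw [this, env_inter Y hEm]
    exact measure_mono_null hYE2 h0
  have hfull : ∀ x ∈ X, μ (E2 ∩ (Prod.mk x) ⁻¹' R) = μ E2 := by
    intro x hx
    have hm : MeasurableSet (E2 \ (Prod.mk x) ⁻¹' R) := hE2m.diff (measurable_prodMk_left hRm)
    have h0 : μ (E2 \ (Prod.mk x) ⁻¹' R) = 0 := by
      have : E2 \ (Prod.mk x) ⁻¹' R = env μ Y ∩ (E2 \ (Prod.mk x) ⁻¹' R) :=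
        (inter_eq_right.2 (fun x hx => hE2Y hx.1)).symm
      rw [this, env_inter Y hm]
      refine measure_mono_null ?_ (ae_iff.1 (hX x hx))
      rintro y ⟨hyY, hyE, hyR⟩ 
      simp only [mem_ofPred_eq, Classical.not_imp]
      refine ⟨hY hyY, fun hxO => hyR ?_⟩
      rw [← hsec y ⟨hyY, hyE.1⟩] at hxO
      exact hxO
    have := measure_inter_add_sdiff (μ := μ) E2 (measurable_prodMk_left (x := x) hRm)
    rw [h0, add_zero] at this
    exact this
  let Q : Set (ℝ × ℝ) := R ∩ (univ ×ˢ E2)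
  have hQm : MeasurableSet Q := hRm.inter (MeasurableSet.univ.prod hE2m)
  have h1 : (μ.prod μ) Q ≤ ε * μ E2 := by
    rw [Measure.prod_apply_symm hQm]
    calc ∫⁻ y, μ ((fun x => (x, y)) ⁻¹' Q) ∂μ ≤ ∫⁻ y, E2.indicator (fun _ => ε) y ∂μ := by
          refine lintegral_mono fun y => ?_
          by_cases hy : y ∈ E2
          · rw [indicator_of_mem hy]
            exact (measure_mono (fun x hx => hx.1)).trans hy.2
          · rw [indicator_of_notMem hy]
            have : (fun x : ℝ => (x, y)) ⁻¹' Q = ∅ := by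
              ext x; simp [Q, hy]
            simp [this]
      _ = ε * μ E2 := by rw [lintegral_indicator hE2m]; simp
  have h2 : μ X * μ E2 ≤ (μ.prod μ) Q := by
    rw [Measure.prod_apply hQm]
    have hh : Measurable fun x => μ (Prod.mk x ⁻¹' Q) := measurable_measure_prodMk_left hQm
    have := mul_meas_ge_le_lintegral (μ := μ) hh (μ E2)
    refine le_trans ?_ this
    rw [mul_comm]
    gcongr
    intro x hx
    change μ E2 ≤ μ (Prod.mk x ⁻¹' Q)
    rw [← hfull x hx]
    refine measure_mono ?_
    rintro y ⟨hy1, hy2⟩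
    exact ⟨hy2, trivial, hy1⟩
  have h3 := h2.trans h1
  rw [ENNReal.mul_le_mul_iff_left hE20 (measure_ne_top _ _)] at h3
  exact absurd h3 (not_le.2 hε)

lemma env_nonempty (S : Set ℝ) : ∀ᵐ x ∂μ, x ∈ env μ S → S.Nonempty := by
  rcases S.eq_empty_or_nonempty with h | h
  · have : μ (env μ S) = 0 := by rw [measure_toMeasurable, h, measure_empty]
    filter_upwards [measure_eq_zero_iff_ae_notMem.1 this] with x hx hx' using absurd hx' hx
  · exact Eventually.of_forall fun _ _ => h

/-- initial segment of length `l` -/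
def res (l : ℕ) (f : ℕ → Bool) : Fin l → Bool := fun i => f i

/-- cylinder -/
def cyl (s : ℝ → ℕ → Bool) (l : ℕ) (σ : Fin l → Bool) : Set ℝ := {y | res l (s y) = σ}

open Classical in
/-- the tree of nodes seen by `x` -/
noncomputable def tree (μ : Measure ℝ) (s : ℝ → ℕ → Bool) (Y : Set ℝ) (x : ℝ) (l : ℕ) :
    Finset (Fin l → Bool) := Finset.univ.filter fun σ => x ∈ env μ (Y ∩ cyl s l σ)

lemma mem_tree {s : ℝ → ℕ → Bool} {Y : Set ℝ} {x : ℝ} {l : ℕ} {σ : Fin l → Bool} :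
    σ ∈ tree μ s Y x l ↔ x ∈ env μ (Y ∩ cyl s l σ) := by
  simp [tree]

/-- coordinates split -/
def Splits (μ : Measure ℝ) (X : Set ℝ) (s : ℝ → ℕ → Bool) : Prop :=
  ∀ Y ⊆ X, ∀ᵐ x ∂μ, x ∈ env μ Y → ∃ i, ∀ b, x ∈ env μ (Y ∩ {y | s y i = b})

lemma growth {X : Set ℝ} {s : ℝ → ℕ → Bool} (hA : Splits μ X s) {Y : Set ℝ} (hY : Y ⊆ X) :
    ∀ᵐ x ∂μ, x ∈ env μ Y → ∀ N, ∃ l0, ∀ l ≥ l0, N ≤ (tree μ s Y x l).card := by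
  have h1 : ∀ᵐ x ∂μ, ∀ l (σ : Fin l → Bool), x ∈ env μ (Y ∩ cyl s l σ) →
      ∃ i, ∀ b, x ∈ env μ ((Y ∩ cyl s l σ) ∩ {y | s y i = b}) := by
    simp_rw [ae_all_iff]
    intro l σ
    exact hA _ (inter_subset_left.trans hY)
  have h2 : ∀ᵐ x ∂μ, ∀ l (σ : Fin l → Bool) i b l', x ∈ env μ ((Y ∩ cyl s l σ) ∩ {y | s y i = b}) →
      ∃ τ : Fin l' → Bool, x ∈ env μ (((Y ∩ cyl s l σ) ∩ {y | s y i = b}) ∩ cyl s l' τ) := by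
    simp_rw [ae_all_iff]
    intro l σ i b l'
    refine env_cover _ fun y hy => mem_iUnion.2 ⟨res l' (s y), hy, rfl⟩
  have h3 : ∀ᵐ x ∂μ, ∀ l (σ : Fin l → Bool) i b l' (τ : Fin l' → Bool),
      x ∈ env μ (((Y ∩ cyl s l σ) ∩ {y | s y i = b}) ∩ cyl s l' τ) →
      (((Y ∩ cyl s l σ) ∩ {y | s y i = b}) ∩ cyl s l' τ).Nonempty := by
    simp_rw [ae_all_iff]
    intro l σ i b l' τ
    exact env_nonempty _
  have h4 : ∀ᵐ x ∂μ, ∀ l (σ : Fin l → Bool) i b l' (τ : Fin l' → Bool),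
      x ∈ env μ (((Y ∩ cyl s l σ) ∩ {y | s y i = b}) ∩ cyl s l' τ) →
      x ∈ env μ (Y ∩ cyl s l' τ) := by
    simp_rw [ae_all_iff]
    intro l σ i b l' τ
    exact env_mono fun y hy => ⟨hy.1.1.1, hy.2⟩
  have h5 : ∀ᵐ x ∂μ, x ∈ env μ Y → ∃ τ : Fin 0 → Bool, x ∈ env μ (Y ∩ cyl s 0 τ) := 
    env_cover _ fun y hy => mem_iUnion.2 ⟨res 0 (s y), hy, rfl⟩
  filter_upwards [h1, h2, h3, h4, h5] with x h1 h2 h3 h4 h5 hx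
  -- key extension
  have hext : ∀ l (σ : Fin l → Bool) (_ : σ ∈ tree μ s Y x l) l' (hl : l ≤ l'),
      ∃ i, ∀ b, ∃ τ ∈ tree μ s Y x l', (∀ j : Fin l, τ (Fin.castLE hl j) = σ j) ∧
        ∀ h : i < l', τ ⟨i, h⟩ = b := by
    intro l σ hσ l' hl
    obtain ⟨i, hi⟩ := h1 l σ (mem_tree.1 hσ)
    refine ⟨i, fun b => ?_⟩
    obtain ⟨τ, hτ⟩ := h2 l σ i b l' (hi b)
    obtain ⟨y, ⟨⟨_, hy1⟩, hy2⟩, hy3⟩ := h3 l σ i b l' τ hτ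
    refine ⟨τ, mem_tree.2 (h4 l σ i b l' τ hτ), fun j => ?_, fun h => ?_⟩
    · rw [← show _ = τ from hy3, ← show _ = σ from hy1]; rfl
    · rw [← show _ = τ from hy3]; exact hy2
  have hmono : ∀ l l', l ≤ l' → (tree μ s Y x l).card ≤ (tree μ s Y x l').card := by
    intro l l' hl
    refine Finset.card_le_card_of_surjOn (fun τ j => τ (Fin.castLE hl j)) ?_
    intro σ hσ
    obtain ⟨i, hi⟩ := hext l σ hσ l' hl
    obtain ⟨τ, hτ, h, _⟩ := hi true
    exact ⟨τ, hτ, funext h⟩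
  have hstrict : ∀ l, (tree μ s Y x l).Nonempty → ∃ l' ≥ l, (tree μ s Y x l).card < (tree μ s Y x l').card := by
    rintro l ⟨σ, hσ⟩
    obtain ⟨i, hi⟩ := h1 l σ (mem_tree.1 hσ)
    have hl : l ≤ max l (i+1) := le_max_left _ _
    have hil : i < max l (i+1) := lt_of_lt_of_le (Nat.lt_succ_self i) (le_max_right _ _)
    refine ⟨max l (i+1), hl, ?_⟩
    have hb : ∀ b, ∃ τ ∈ tree μ s Y x (max l (i+1)), (∀ j : Fin l, τ (Fin.castLE hl j) = σ j) ∧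
        τ ⟨i, hil⟩ = b := by
      intro b
      obtain ⟨τ, hτ⟩ := h2 l σ i b (max l (i+1)) (hi b)
      obtain ⟨y, ⟨⟨_, hy1⟩, hy2⟩, hy3⟩ := h3 l σ i b _ τ hτ
      refine ⟨τ, mem_tree.2 (h4 l σ i b _ τ hτ), fun j => ?_, ?_⟩
      · rw [← show _ = τ from hy3, ← show _ = σ from hy1]; rfl
      · rw [← show _ = τ from hy3]; exact hy2
    obtain ⟨τ1, ht1, hr1, hv1⟩ := hb true
    obtain ⟨τ2, ht2, hr2, hv2⟩ := hb false
    by_contra hc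
    push Not at hc
    have hsurj : SurjOn (fun (τ : Fin (max l (i+1)) → Bool) (j : Fin l) => τ (Fin.castLE hl j))
        (tree μ s Y x (max l (i+1)) : Set _) (tree μ s Y x l : Set _) := by
      intro σ hσ
      obtain ⟨i, hi⟩ := hext l σ hσ _ hl
      obtain ⟨τ, hτ, h, _⟩ := hi true
      exact ⟨τ, hτ, funext h⟩
    have hsurj' : SurjOn (fun (τ : Fin (max l (i+1)) → Bool) (j : Fin l) => τ (Fin.castLE hl j))
        ((tree μ s Y x (max l (i+1))).erase τ2 : Set _) (tree μ s Y x l : Set _) := by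
      intro σ' hσ'
      obtain ⟨τ, hτ, h⟩ := hsurj hσ'
      by_cases he : τ = τ2
      · refine ⟨τ1, ?_, ?_⟩
        · rw [Finset.mem_coe, Finset.mem_erase]
          refine ⟨?_, ht1⟩
          rintro rfl
          rw [hv1] at hv2
          cases hv2
        · rw [← h, he]
          funext j
          simp only [hr1, hr2]
      · exact ⟨τ, by rw [Finset.mem_coe, Finset.mem_erase]; exact ⟨he, hτ⟩, h⟩
    have := Finset.card_le_card_of_surjOn _ hsurj'
    rw [Finset.card_erase_of_mem ht2] at this
    have hp : 0 < (tree μ s Y x (max l (i+1))).card := Finset.card_pos.2 ⟨_, ht2⟩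
    omega
  have hN : ∀ N, ∃ l, N + 1 ≤ (tree μ s Y x l).card := by
    intro N
    induction N with
    | zero =>
      obtain ⟨τ, hτ⟩ := h5 hx
      exact ⟨0, Finset.card_pos.2 ⟨τ, mem_tree.2 hτ⟩⟩
    | succ N ih =>
      obtain ⟨l, hl⟩ := ih
      obtain ⟨l', _, h⟩ := hstrict l (Finset.card_pos.1 (by omega))
      exact ⟨l', by omega⟩
  intro N
  obtain ⟨l0, h0⟩ := hN N
  exact ⟨l0, fun l hl => by have := hmono l0 l hl; omega⟩

lemma card_avoid {K : Type*} [Fintype K] [DecidableEq K] (T : Finset K) (e : Bool)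
    [DecidablePred fun φ : K → Bool => ∀ τ ∈ T, φ τ ≠ e] :
    (Finset.univ.filter fun φ : K → Bool => ∀ τ ∈ T, φ τ ≠ e).card * 2 ^ T.card
      = 2 ^ Fintype.card K := by
  have h1 : (Finset.univ.filter fun φ : K → Bool => ∀ τ ∈ T, φ τ ≠ e)
      = Fintype.piFinset fun τ => if τ ∈ T then {!e} else Finset.univ := by
    ext φ
    simp only [Finset.mem_filter, Finset.mem_univ, true_and, Fintype.mem_piFinset]
    refine forall_congr' fun τ => ?_
    by_cases h : τ ∈ T
    · simp only [h, true_imp_iff, if_true, Finset.mem_singleton]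
      cases φ τ <;> cases e <;> simp
    · simp [h]
  rw [h1, Fintype.card_piFinset]
  have h2 : ∀ τ : K, (if τ ∈ T then ({!e} : Finset Bool) else Finset.univ).card
      = if τ ∈ T then 1 else 2 := by
    intro τ; split_ifs <;> simp
  simp_rw [h2]
  rw [Finset.prod_ite]
  simp only [Finset.prod_const, one_pow, one_mul]
  rw [← pow_add]
  congr 1
  have h3 : (Finset.univ.filter fun τ : K => τ ∉ T) = Tᶜ := by ext; simp
  rw [h3, Finset.card_compl]
  exact Nat.sub_add_cancel (Finset.card_le_univ T)

lemma card_aux (a M N t : ℕ) (hc : a * 2 ^ t = 2 ^ M) (hN : N ≤ t) :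
    (a : ENNReal) ≤ 2 ^ M * (2⁻¹ : ENNReal) ^ N := by
  have h1 : a * 2 ^ N ≤ 2 ^ M := by
    rw [← hc]
    exact Nat.mul_le_mul_left _ (Nat.pow_le_pow_right (by norm_num) hN)
  have h2 : (a : ENNReal) * 2 ^ N ≤ 2 ^ M := by
    exact_mod_cast h1
  have h3 : (2 : ENNReal) ^ N * (2⁻¹ : ENNReal) ^ N = 1 := by
    rw [← mul_pow, ENNReal.mul_inv_cancel (by norm_num) (by norm_num), one_pow]
  calc (a : ENNReal) = (a : ENNReal) * (2 ^ N * (2⁻¹ : ENNReal) ^ N) := by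
        rw [h3, mul_one]
    _ = a * 2 ^ N * (2⁻¹ : ENNReal) ^ N := by rw [mul_assoc]
    _ ≤ _ := by gcongr

lemma meas_big (s : ℝ → ℕ → Bool) (Y : Set ℝ) (l N : ℕ) :
    MeasurableSet {x | N ≤ (tree μ s Y x l).card} := by
  have : {x | N ≤ (tree μ s Y x l).card}
      = ⋃ F : {F : Finset (Fin l → Bool) // N ≤ F.card}, ⋂ σ ∈ F.1, env μ (Y ∩ cyl s l σ) := by
    ext x
    simp only [mem_ofPred_eq, mem_iUnion, mem_iInter]
    constructor
    · intro h
      exact ⟨⟨_, h⟩, fun σ hσ => mem_tree.1 hσ⟩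
    · rintro ⟨⟨F, hF⟩, h⟩
      exact hF.trans (Finset.card_le_card fun σ hσ => mem_tree.2 (h σ hσ))
  rw [this]
  exact MeasurableSet.iUnion fun F => Finset.measurableSet_biInter _ fun σ _ => env_meas _

lemma avg_bound (s : ℝ → ℕ → Bool) (Y : Set ℝ) (l N : ℕ) (e : Bool) :
    ∑ φ : (Fin l → Bool) → Bool,
      μ {x | N ≤ (tree μ s Y x l).card ∧ ∀ τ ∈ tree μ s Y x l, φ τ ≠ e}
      ≤ 2 ^ Fintype.card (Fin l → Bool) * ((2⁻¹ : ENNReal) ^ N * μ univ) := by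
  classical
  have hm : ∀ φ : (Fin l → Bool) → Bool,
      MeasurableSet {x | N ≤ (tree μ s Y x l).card ∧ ∀ τ ∈ tree μ s Y x l, φ τ ≠ e} := by
    intro φ
    have : {x | N ≤ (tree μ s Y x l).card ∧ ∀ τ ∈ tree μ s Y x l, φ τ ≠ e}
        = {x | N ≤ (tree μ s Y x l).card} ∩
          ⋂ τ : {τ : Fin l → Bool // φ τ = e}, (env μ (Y ∩ cyl s l τ.1))ᶜ := by
      ext x
      simp only [mem_ofPred_eq, mem_inter_iff, mem_iInter, mem_compl_iff, mem_tree, Subtype.forall]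
      refine and_congr_right fun _ => forall_congr' fun τ => ?_
      tauto
    rw [this]
    exact (meas_big s Y l N).inter (MeasurableSet.iInter fun τ => (env_meas _).compl)
  calc _ = ∑ φ : (Fin l → Bool) → Bool, ∫⁻ x, indicator
        {x | N ≤ (tree μ s Y x l).card ∧ ∀ τ ∈ tree μ s Y x l, φ τ ≠ e} 1 x ∂μ := by
        refine Finset.sum_congr rfl fun φ _ => ?_
        rw [lintegral_indicator_one (hm φ)]
    _ = ∫⁻ x, ∑ φ : (Fin l → Bool) → Bool, indicator
        {x | N ≤ (tree μ s Y x l).card ∧ ∀ τ ∈ tree μ s Y x l, φ τ ≠ e} 1 x ∂μ := by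
        rw [lintegral_finsetSum]
        exact fun φ _ => measurable_one.indicator (hm φ)
    _ ≤ ∫⁻ x, 2 ^ Fintype.card (Fin l → Bool) * (2⁻¹ : ENNReal) ^ N ∂μ := by
        refine lintegral_mono fun x => ?_
        simp only [indicator_apply, mem_ofPred_eq, Pi.one_apply]
        by_cases hN : N ≤ (tree μ s Y x l).card
        · simp only [hN, true_and]
          rw [Finset.sum_boole]
          have hc := card_avoid (tree μ s Y x l) e
          exact card_aux _ _ _ _ hc hN
        · simp [hN]
    _ = _ := by rw [lintegral_const, mul_assoc]

lemma coloring {X : Set ℝ} {s : ℝ → ℕ → Bool} (hA : Splits μ X s) {ι : Type*} [Fintype ι]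
    (Y : ι → Set ℝ) (hY : ∀ q, Y q ⊆ X) (δ : ENNReal) (hδ : δ ≠ 0) :
    ∃ ψ : (ℕ → Bool) → Bool,
      μ {x | ∃ q, x ∈ env μ (Y q) ∧ ∃ e, x ∉ env μ (Y q ∩ {y | ψ (s y) = e})} ≤ δ := by
  classical
  have hδ2 : 0 < δ / 2 := ENNReal.half_pos hδ
  obtain ⟨N, hN⟩ : ∃ N : ℕ, (Fintype.card ι * 2 * μ univ : ENNReal) * (2⁻¹ : ENNReal) ^ N ≤ δ / 2 := by
    have ht : Tendsto (fun N : ℕ => (Fintype.card ι * 2 * μ univ : ENNReal) * (2⁻¹ : ENNReal) ^ N)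
        atTop (nhds ((Fintype.card ι * 2 * μ univ : ENNReal) * 0)) :=
      ENNReal.Tendsto.const_mul (ENNReal.tendsto_pow_atTop_nhds_zero_of_lt_one (by norm_num))
        (Or.inr (by finiteness))
    rw [mul_zero] at ht
    obtain ⟨N, h⟩ := (ht.eventually_lt_const hδ2).exists
    exact ⟨N, h.le⟩
  let Bad : ℕ → Set ℝ := fun l => ⋃ q, (env μ (Y q) ∩ {x | N ≤ (tree μ s (Y q) x l).card}ᶜ)
  have hBm : ∀ l, MeasurableSet (Bad l) := fun l =>
    MeasurableSet.iUnion fun q => (env_meas _).inter (meas_big _ _ _ _).compl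
  obtain ⟨l, hl⟩ : ∃ l, μ (Bad l) ≤ δ / 2 := by
    have hall : ∀ᵐ x ∂μ, ∀ q, x ∈ env μ (Y q) → ∀ N, ∃ l0, ∀ l ≥ l0, N ≤ (tree μ s (Y q) x l).card :=
      ae_all_iff.2 fun q => growth hA (hY q)
    have ht := tendsto_measure_of_ae_tendsto_indicator_of_isFiniteMeasure (μ := μ) (A := ∅) atTop
      MeasurableSet.empty hBm (by
        filter_upwards [hall] with x hx
        have : ∀ q, ∃ l0, ∀ l ≥ l0, x ∈ env μ (Y q) → N ≤ (tree μ s (Y q) x l).card := by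
          intro q
          by_cases hq : x ∈ env μ (Y q)
          · obtain ⟨l0, h⟩ := hx q hq N
            exact ⟨l0, fun l hl _ => h l hl⟩
          · exact ⟨0, fun _ _ h => absurd h hq⟩
        choose l0 hl0 using this
        filter_upwards [eventually_ge_atTop (Finset.univ.sup l0)] with l hl
        simp only [mem_empty_iff_false, iff_false]
        intro hb
        obtain ⟨q, hq1, hq2⟩ := mem_iUnion.1 hb
        exact hq2 (hl0 q l ((Finset.le_sup (Finset.mem_univ q)).trans hl) hq1))
    rw [measure_empty] at ht
    obtain ⟨l, h⟩ := (ht.eventually_lt_const hδ2).exists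
    exact ⟨l, h.le⟩
  let V : ((Fin l → Bool) → Bool) → ι → Bool → Set ℝ := fun φ q e =>
    {x | N ≤ (tree μ s (Y q) x l).card ∧ ∀ τ ∈ tree μ s (Y q) x l, φ τ ≠ e}
  obtain ⟨φ, hφ⟩ : ∃ φ : (Fin l → Bool) → Bool, ∑ q, ∑ e, μ (V φ q e) ≤ δ / 2 := by
    obtain ⟨φ, _, h⟩ := ENNReal.exists_le_of_sum_le
      (s := (Finset.univ : Finset ((Fin l → Bool) → Bool))) ⟨fun _ => true, Finset.mem_univ _⟩
      (f := fun φ => ∑ q, ∑ e, μ (V φ q e)) (g := fun _ => δ / 2) (by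
        rw [Finset.sum_comm]
        simp_rw [Finset.sum_comm (s := (Finset.univ : Finset ((Fin l → Bool) → Bool)))]
        calc ∑ q : ι, ∑ e : Bool, ∑ φ, μ (V φ q e)
            ≤ ∑ q : ι, ∑ e : Bool, 2 ^ Fintype.card (Fin l → Bool) * ((2⁻¹ : ENNReal) ^ N * μ univ) :=
              Finset.sum_le_sum fun q _ => Finset.sum_le_sum fun e _ => avg_bound s (Y q) l N e
          _ = 2 ^ Fintype.card (Fin l → Bool) *
              ((Fintype.card ι * 2 * μ univ : ENNReal) * (2⁻¹ : ENNReal) ^ N) := by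
              simp only [Finset.sum_const, Finset.card_univ, Fintype.card_bool, nsmul_eq_mul]
              push_cast; ring
          _ ≤ 2 ^ Fintype.card (Fin l → Bool) * (δ / 2) := by gcongr
          _ = _ := by
              have h5 : Fintype.card ((Fin l → Bool) → Bool) = 2 ^ Fintype.card (Fin l → Bool) := by
                rw [Fintype.card_fun, Fintype.card_bool]
              rw [Finset.sum_const, Finset.card_univ, nsmul_eq_mul, h5]
              push_cast; rfl)
    exact ⟨φ, h⟩
  refine ⟨fun f => φ (res l f), ?_⟩
  have hmono : ∀ᵐ x ∂μ, ∀ q e (τ : Fin l → Bool), φ τ = e → x ∈ env μ (Y q ∩ cyl s l τ) →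
      x ∈ env μ (Y q ∩ {y | φ (res l (s y)) = e}) := by
    simp_rw [ae_all_iff]
    intro q e τ hτ
    exact env_mono fun y hy => ⟨hy.1, by rw [mem_ofPred_eq, show _ = τ from hy.2, hτ]⟩
  calc _ ≤ μ (Bad l ∪ ⋃ q, ⋃ e, V φ q e) := by
        refine measure_mono_ae ?_
        filter_upwards [hmono] with x hx hxb
        obtain ⟨q, hq, e, he⟩ := hxb
        by_cases hc : N ≤ (tree μ s (Y q) x l).card
        · right
          refine mem_iUnion.2 ⟨q, mem_iUnion.2 ⟨e, hc, fun τ hτ hφτ => he ?_⟩⟩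
          exact hx q e τ hφτ (mem_tree.1 hτ)
        · left
          exact mem_iUnion.2 ⟨q, hq, hc⟩
    _ ≤ μ (Bad l) + μ (⋃ q, ⋃ e, V φ q e) := measure_union_le _ _
    _ ≤ δ / 2 + δ / 2 := by
        refine add_le_add hl (le_trans ?_ hφ)
        refine (measure_iUnion_fintype_le _ _).trans (Finset.sum_le_sum fun q _ => ?_)
        exact measure_iUnion_fintype_le _ _
    _ = δ := ENNReal.add_halves δ

/-- points of `A` whose colors vanish on `[j0, j)` -/
def zset (s : ℝ → ℕ → Bool) (h : ℕ → (ℕ → Bool) → Bool) (A : Set ℝ) (j0 j : ℕ) : Set ℝ :=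
  A ∩ {y | ∀ k, j0 ≤ k → k < j → h k (s y) = false}

lemma exists_w {X : Set ℝ} {s : ℝ → ℕ → Bool} (hA : Splits μ X s)
    (A : ℕ → Set ℝ) (hAX : ∀ m, A m ⊆ X) :
    ∃ w : (ℕ → Bool) → ℕ → ℕ, ∀ m, ∀ᵐ x ∂μ, x ∈ env μ (A m) →
      ∀ᶠ j in atTop, ∀ v, x ∈ env μ (A m ∩ {y | w (s y) j = v}) := by
  have hstep : ∀ (j : ℕ) (h : ℕ → (ℕ → Bool) → Bool), ∃ ψ : (ℕ → Bool) → Bool,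
      μ {x | ∃ q : Fin (j+1) × Fin (j+1), x ∈ env μ (zset s h (A q.1) q.2 j) ∧
        ∃ e, x ∉ env μ (zset s h (A q.1) q.2 j ∩ {y | ψ (s y) = e})} ≤ (1/2 : ENNReal) ^ j := by
    intro j h
    refine coloring hA (fun q : Fin (j+1) × Fin (j+1) => zset s h (A q.1) q.2 j)
      (fun q => inter_subset_left.trans (hAX _)) _ ?_
    exact (ENNReal.pow_pos (by simp) j).ne'
  choose Φ hΦ using hstep
  let H : ℕ → ℕ → (ℕ → Bool) → Bool := fun j => Nat.rec (fun _ _ => true)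
    (fun j h => Function.update h j (Φ j h)) j
  have hH : ∀ j, H (j+1) = Function.update (H j) j (Φ j (H j)) := fun j => rfl
  let ψ : ℕ → (ℕ → Bool) → Bool := fun j => H (j+1) j
  have hψ : ∀ j, ψ j = Φ j (H j) := by
    intro j
    change H (j+1) j = _
    rw [hH, Function.update_self]
  have hHψ : ∀ k j, k < j → H j k = ψ k := by
    intro k j hkj
    induction j with
    | zero => omega
    | succ j ih =>
      by_cases h : k = j
      · subst h; rfl
      · rw [hH, Function.update_of_ne h]
        exact ih (by omega)
  have hz : ∀ B j0 j, zset s (H j) B j0 j = zset s ψ B j0 j := by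
    intro B j0 j
    ext y
    simp only [zset, mem_inter_iff, mem_ofPred_eq]
    refine and_congr_right fun _ => forall_congr' fun k => forall_congr' fun _ =>
      forall_congr' fun hk => ?_
    rw [hHψ k j hk]
  have hbad : ∀ j, μ {x | ∃ q : Fin (j+1) × Fin (j+1), x ∈ env μ (zset s ψ (A q.1) q.2 j) ∧
        ∃ e, x ∉ env μ (zset s ψ (A q.1) q.2 j ∩ {y | ψ j (s y) = e})} ≤ (1/2 : ENNReal) ^ j := by
    intro j
    have := hΦ j (H j)
    simp_rw [hz, ← hψ] at this
    exact this
  have hs : ∑' j, μ {x | ∃ q : Fin (j+1) × Fin (j+1), x ∈ env μ (zset s ψ (A q.1) q.2 j) ∧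
        ∃ e, x ∉ env μ (zset s ψ (A q.1) q.2 j ∩ {y | ψ j (s y) = e})} ≠ ⊤ := by
    refine ne_top_of_le_ne_top ?_ (ENNReal.tsum_le_tsum hbad)
    rw [ENNReal.tsum_geometric]
    simp
  have hbc := ae_eventually_notMem hs
  refine ⟨fun f j => sInf {v | ψ (j+v) f = true}, fun m => ?_⟩
  have hmono : ∀ᵐ x ∂μ, ∀ j v, x ∈ env μ (zset s ψ (A m) j (j+v) ∩ {y | ψ (j+v) (s y) = true}) →
      x ∈ env μ (A m ∩ {y | sInf {v | ψ (j+v) (s y) = true} = v}) := by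
    simp_rw [ae_all_iff]
    intro j v
    refine env_mono ?_
    rintro y ⟨⟨h1, h2⟩, h3⟩
    refine ⟨h1, ?_⟩
    have hle : sInf {v | ψ (j+v) (s y) = true} ≤ v := Nat.sInf_le h3
    have hmem : sInf {v | ψ (j+v) (s y) = true} ∈ {v | ψ (j+v) (s y) = true} :=
      Nat.sInf_mem ⟨v, h3⟩
    rcases hle.lt_or_eq with h | h
    · have := h2 (j + sInf {v | ψ (j+v) (s y) = true}) (by omega) (by omega)
      rw [show _ = true from hmem] at this
      cases this
    · exact h
  filter_upwards [hbc, hmono] with x hx hmono hxm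
  obtain ⟨J, hJ⟩ := eventually_atTop.1 hx
  filter_upwards [eventually_ge_atTop (max J m)] with j0 hj0
  have hgood : ∀ j ≥ j0, x ∈ env μ (zset s ψ (A m) j0 j) →
      ∀ e, x ∈ env μ (zset s ψ (A m) j0 j ∩ {y | ψ j (s y) = e}) := by
    intro j hj hxz e
    by_contra hc
    refine hJ j ((le_max_left _ _).trans (hj0.trans hj)) ?_
    refine ⟨(⟨m, ?_⟩, ⟨j0, ?_⟩), hxz, e, hc⟩
    · have := le_max_right J m
      omega
    · omega
  have hZ : ∀ v, x ∈ env μ (zset s ψ (A m) j0 (j0+v)) := by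
    intro v
    induction v with
    | zero =>
      have : zset s ψ (A m) j0 (j0+0) = A m := by
        ext y
        simp only [zset, mem_inter_iff, mem_ofPred_eq, and_iff_left_iff_imp]
        intro _ k h1 h2
        omega
      rw [this]
      exact hxm
    | succ v ih =>
      have := hgood (j0+v) (by omega) ih false
      have he : zset s ψ (A m) j0 (j0+v) ∩ {y | ψ (j0+v) (s y) = false}
          = zset s ψ (A m) j0 (j0+(v+1)) := by
        ext y
        simp only [zset, mem_inter_iff, mem_ofPred_eq, and_assoc]
        refine and_congr_right fun _ => ?_
        constructor
        · rintro ⟨h1, h2⟩ k hk1 hk2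
          rcases (show k < j0 + v ∨ k = j0 + v by omega) with h | rfl
          · exact h1 k hk1 h
          · exact h2
        · intro h
          exact ⟨fun k h1 h2 => h k h1 (by omega), h _ (by omega) (by omega)⟩
      rwa [he] at this
  intro v
  exact hmono j0 v (hgood (j0+v) (by omega) (hZ v) true)

/-- the sets `A n`, localized, form a dense family of subsets of `X` -/
def DenseFam (μ : Measure ℝ) (X : Set ℝ) (A : ℕ → Set ℝ) : Prop :=
  ∀ Y ⊆ X, μ Y ≠ 0 → ∃ n E, MeasurableSet E ∧ μ (A n ∩ E) ≠ 0 ∧ μ ((A n ∩ E) \ Y) = 0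

lemma transfer {X : Set ℝ} {A : ℕ → Set ℝ} (hH : DenseFam μ X A) {S : Set ℝ} (hS : S ⊆ X)
    (hS0 : μ S ≠ 0) {ι : Type*} [Countable ι] (C : ι → Set ℝ) {p : ℝ → Prop}
    (hp : ∀ᵐ x ∂μ, p x) :
    ∃ m x, p x ∧ x ∈ env μ (A m) ∧ x ∈ env μ S ∧
      ∀ i, x ∈ env μ (A m ∩ C i) → x ∈ env μ (S ∩ C i) ∧ (S ∩ C i).Nonempty := by
  obtain ⟨n, E, hE, h0, h1⟩ := hH S hS hS0
  have hne : μ (env μ (A n) ∩ E) ≠ 0 := by rwa [env_inter _ hE]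
  have ha : ∀ᵐ x ∂μ, x ∈ E → x ∈ env μ (A n) → x ∈ env μ S := env_mono_local hE h1
  have hb : ∀ᵐ x ∂μ, ∀ i, x ∈ E → x ∈ env μ (A n ∩ C i) → x ∈ env μ (S ∩ C i) := by
    rw [ae_all_iff]
    intro i
    refine env_mono_local hE (measure_mono_null ?_ h1)
    rintro x ⟨⟨⟨hx1, hx2⟩, hx3⟩, hx4⟩
    exact ⟨⟨hx1, hx3⟩, fun h => hx4 ⟨h, hx2⟩⟩
  have hc : ∀ᵐ x ∂μ, ∀ i, x ∈ env μ (S ∩ C i) → (S ∩ C i).Nonempty :=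
    ae_all_iff.2 fun i => env_nonempty _
  by_contra hcon
  apply hne
  refine measure_eq_zero_iff_ae_notMem.2 ?_
  filter_upwards [hp, ha, hb, hc] with x hp ha hb hc hx
  exact hcon ⟨n, x, hp, hx.1, ha hx.2 hx.1, fun i hi => ⟨hb i hx.2 hi, hc i (hb i hx.2 hi)⟩⟩

/-- `w` takes all values in a strong sense -/
def Wild (μ : Measure ℝ) (X : Set ℝ) (w : ℝ → ℕ → ℕ) : Prop :=
  ∀ Y ⊆ X, ∀ᵐ x ∂μ, x ∈ env μ Y → ∀ᶠ j in atTop, ∀ v, x ∈ env μ (Y ∩ {y | w y j = v})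

lemma wild_of {X : Set ℝ} {A : ℕ → Set ℝ} (hH : DenseFam μ X A) {w : ℝ → ℕ → ℕ}
    (hw : ∀ m, ∀ᵐ x ∂μ, x ∈ env μ (A m) →
      ∀ᶠ j in atTop, ∀ v, x ∈ env μ (A m ∩ {y | w y j = v})) : Wild μ X w := by
  intro Y hY
  let G : Set ℝ := env μ Y \ ⋃ J : ℕ, ⋂ j : {j // J ≤ j}, ⋂ v, env μ (Y ∩ {y | w y j = v})
  have hGm : MeasurableSet G := (env_meas _).diff (MeasurableSet.iUnion fun J =>
    MeasurableSet.iInter fun j => MeasurableSet.iInter fun v => env_meas _)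
  have hGiff : ∀ x, x ∈ G ↔ x ∈ env μ Y ∧
      ¬ ∀ᶠ j in atTop, ∀ v, x ∈ env μ (Y ∩ {y | w y j = v}) := by
    intro x
    simp only [G, Set.mem_sdiff, mem_iUnion, mem_iInter, Subtype.forall, eventually_atTop]
  by_cases hG0 : μ G = 0
  · filter_upwards [measure_eq_zero_iff_ae_notMem.1 hG0] with x hx hxY
    by_contra hc
    exact hx ((hGiff x).2 ⟨hxY, hc⟩)
  exfalso
  have hS0 : μ (Y ∩ G) ≠ 0 := by
    rw [← env_inter Y hGm, inter_eq_right.2 (fun x hx => hx.1)]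
    exact hG0
  have h1 : ∀ᵐ x ∂μ, x ∈ env μ (Y ∩ G) → x ∈ G := by
    have : μ (env μ (Y ∩ G) ∩ Gᶜ) = 0 := by
      rw [env_inter _ hGm.compl]
      have : Y ∩ G ∩ Gᶜ = ∅ := by ext; simp
      rw [this, measure_empty]
    filter_upwards [measure_eq_zero_iff_ae_notMem.1 this] with x hx hx1
    by_contra hc
    exact hx ⟨hx1, hc⟩
  have h2 : ∀ᵐ x ∂μ, ∀ j v, x ∈ env μ (Y ∩ G ∩ {y | w y j = v}) → x ∈ env μ (Y ∩ {y | w y j = v}) := by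
    simp_rw [ae_all_iff]
    intro j v
    exact env_mono fun y hy => ⟨hy.1.1, hy.2⟩
  obtain ⟨m, x, ⟨hx1, hx2, hx3⟩, hxm, hxS, hxC⟩ := transfer hH (inter_subset_left.trans hY) hS0
    (fun q : ℕ × ℕ => {y | w y q.1 = q.2}) ((h1.and (h2.and (ae_all_iff.2 hw))))
  have hxG := hx1 hxS
  refine ((hGiff x).1 hxG).2 ?_
  filter_upwards [hx3 m hxm] with j hj v
  exact hx2 j v (hxC (j, v) (hj v)).1

lemma wild_unbdd {X : Set ℝ} {w : ℝ → ℕ → ℕ} (hw : Wild μ X w) (g : ℕ → ℕ) :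
    μ {y ∈ X | ∀ᶠ j in atTop, w y j ≤ g j} = 0 := by
  have : {y ∈ X | ∀ᶠ j in atTop, w y j ≤ g j} ⊆ ⋃ J : ℕ, {y ∈ X | ∀ j ≥ J, w y j ≤ g j} := by
    rintro y ⟨hy, h⟩
    obtain ⟨J, hJ⟩ := eventually_atTop.1 h
    exact mem_iUnion.2 ⟨J, hy, hJ⟩
  refine measure_mono_null this (measure_iUnion_null fun J => ?_)
  set Y := {y ∈ X | ∀ j ≥ J, w y j ≤ g j} with hYdef
  have hY : Y ⊆ X := fun y hy => hy.1
  rw [← measure_toMeasurable]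
  have hne : ∀ᵐ x ∂μ, ∀ j v, x ∈ env μ (Y ∩ {y | w y j = v}) → (Y ∩ {y | w y j = v}).Nonempty := by
    simp_rw [ae_all_iff]
    intro j v
    exact env_nonempty _
  refine measure_eq_zero_iff_ae_notMem.2 ?_
  filter_upwards [hw Y hY, hne] with x hx hne hxY
  obtain ⟨j, hj, hjJ⟩ := ((hx hxY).and (eventually_ge_atTop J)).exists
  obtain ⟨y, hy1, hy2⟩ := hne j _ (hj (g j + 1))
  have := hy1.2 j hjJ
  rw [show w y j = _ from hy2] at this
  omega

lemma dom_bound {X : Set ℝ} {A : ℕ → Set ℝ} (hH : DenseFam μ X A) (hX0 : μ X ≠ 0)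
    (G : ℝ → ℕ → ℕ) : ∃ g : ℕ → ℕ, ∀ f : ℕ → ℕ,
      (∀ᵐ y ∂μ, y ∈ X → ∀ᶠ k in atTop, f k ≤ G y k) → ∀ᶠ k in atTop, f k ≤ g k := by
  obtain ⟨g, hg⟩ := rb (μ := μ) (fun m => env μ (A m)) (fun m => env_meas _)
    (fun m k J => env μ (A m ∩ {y | G y k = J})) (fun _ _ _ => env_meas _) (fun m k =>
      env_cover _ fun y hy => mem_iUnion.2 ⟨G y k, hy, rfl⟩)
  refine ⟨g, fun f hf => ?_⟩
  obtain ⟨K, hK⟩ : ∃ K : ℕ, μ {y ∈ X | ∀ k ≥ K, f k ≤ G y k} ≠ 0 := by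
    by_contra hc
    push Not at hc
    apply hX0
    refine measure_mono_null (t := {y | ¬ (y ∈ X → ∀ᶠ k in atTop, f k ≤ G y k)} ∪
      ⋃ K : ℕ, {y ∈ X | ∀ k ≥ K, f k ≤ G y k}) ?_
      (measure_union_null (ae_iff.1 hf) (measure_iUnion_null hc))
    intro y hy
    by_cases h : y ∈ X → ∀ᶠ k in atTop, f k ≤ G y k
    · right
      obtain ⟨K, hK⟩ := eventually_atTop.1 (h hy)
      exact mem_iUnion.2 ⟨K, hy, hK⟩
    · left; exact h
  obtain ⟨m, x, hx, hxm, _, hxC⟩ := transfer hH (fun y hy => hy.1) hK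
    (fun q : ℕ × ℕ => {y | G y q.1 = q.2}) hg
  filter_upwards [hx m hxm, eventually_ge_atTop K] with k ⟨J, hJ, hxJ⟩ hkK
  obtain ⟨y, hy1, hy2⟩ := (hxC (k, J) hxJ).2
  have h1 := hy1.2 k hkK
  rw [show G y k = J from hy2] at h1
  exact h1.trans hJ

lemma evdiff {X : Set ℝ} {A : ℕ → Set ℝ} (hAX : ∀ m, A m ⊆ X) (hH : DenseFam μ X A)
    (hX0 : μ X ≠ 0)
    {w : ℝ → ℕ → ℕ} (hw : Wild μ X w) {ι : Type*} (u : ι → ℕ → ℕ)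
    (hu : ∀ g : ℕ → ℕ, ∃ i, ∃ᶠ k in atTop, g k < u i k) :
    ∃ y0, ∀ f : ℕ → ℕ, ∃ i, ∃ᶠ k in atTop, w y0 (u i k) = f k := by
  by_contra hcon
  push Not at hcon
  choose F hF using hcon
  obtain ⟨g, hg⟩ := rb (μ := μ) (fun m => env μ (A m)) (fun m => env_meas _)
    (fun m k J => ⋃ v, ⋂ j : {j // J ≤ j}, env μ (A m ∩ {y | F y k = v} ∩ {y | w y j = v}))
    (fun _ _ _ => MeasurableSet.iUnion fun _ => MeasurableSet.iInter fun _ => env_meas _)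
    (fun m k => by
      have h1 : ∀ᵐ x ∂μ, x ∈ env μ (A m) → ∃ v, x ∈ env μ (A m ∩ {y | F y k = v}) :=
        env_cover _ fun y hy => mem_iUnion.2 ⟨F y k, hy, rfl⟩
      have h2 : ∀ᵐ x ∂μ, ∀ v, x ∈ env μ (A m ∩ {y | F y k = v}) →
          ∀ᶠ j in atTop, ∀ v', x ∈ env μ (A m ∩ {y | F y k = v} ∩ {y | w y j = v'}) :=
        ae_all_iff.2 fun v => hw _ (inter_subset_left.trans (hAX m))
      filter_upwards [h1, h2] with x h1 h2 hx
      obtain ⟨v, hv⟩ := h1 hx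
      obtain ⟨J, hJ⟩ := eventually_atTop.1 (h2 v hv)
      exact ⟨J, mem_iUnion.2 ⟨v, mem_iInter.2 fun j => hJ j.1 j.2 v⟩⟩)
  obtain ⟨i, hi⟩ := hu g
  obtain ⟨K, hK⟩ : ∃ K : ℕ, μ {y ∈ X | ∀ k ≥ K, w y (u i k) ≠ F y k} ≠ 0 := by
    by_contra hc
    push Not at hc
    apply hX0
    refine measure_mono_null (t := ⋃ K : ℕ, {y ∈ X | ∀ k ≥ K, w y (u i k) ≠ F y k}) ?_
      (measure_iUnion_null hc)
    intro y hy
    have h := hF y i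
    obtain ⟨K, hK⟩ := eventually_atTop.1 h
    exact mem_iUnion.2 ⟨K, hy, hK⟩
  obtain ⟨m, x, hx, hxm, _, hxC⟩ := transfer hH (fun y hy => hy.1) hK
    (fun q : ℕ × ℕ × ℕ => {y | F y q.1 = q.2.1} ∩ {y | w y q.2.2 = q.2.1}) hg
  obtain ⟨k, hk1, ⟨J, hJ, hxJ⟩, hkK⟩ :=
    (hi.and_eventually ((hx m hxm).and (eventually_ge_atTop K))).exists
  obtain ⟨v, hv⟩ := mem_iUnion.1 hxJ
  have hv' := mem_iInter.1 hv ⟨u i k, hJ.trans hk1.le⟩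
  rw [inter_assoc] at hv'
  obtain ⟨y, hy1, hy2, hy3⟩ := (hxC (k, v, u i k) hv').2
  exact hy1.2 k hkK (by rw [show w y (u i k) = v from hy3, show F y k = v from hy2])

lemma null_cover {ι : Type*} (I : ℕ → Set ℝ)
    (hI : ∀ (x : ℝ) (k : ℕ), ∃ n, x ∈ I n ∧ μ (I n) ≤ (1/2 : ENNReal) ^ k)
    (z : ι → ℕ → ℕ) (hz : ∀ f : ℕ → ℕ, ∃ i, ∃ᶠ k in atTop, z i k = f k) :
    ∃ N : ι → Set ℝ, (∀ i, μ (N i) = 0) ∧ ∀ x, ∃ i, x ∈ N i := by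
  refine ⟨fun i => {x | ∃ᶠ k in atTop, x ∈ I (z i k) ∧ μ (I (z i k)) ≤ (1/2 : ENNReal) ^ k},
    fun i => ?_, fun x => ?_⟩
  · have := measure_setOfPred_frequently_eq_zero (μ := μ)
      (p := fun k x => x ∈ I (z i k) ∧ μ (I (z i k)) ≤ (1/2 : ENNReal) ^ k) (by
      have hb : ∀ k, μ {x | x ∈ I (z i k) ∧ μ (I (z i k)) ≤ (1/2 : ENNReal) ^ k} ≤
          (1/2 : ENNReal) ^ k := by
        intro k
        by_cases h : μ (I (z i k)) ≤ (1/2 : ENNReal) ^ k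
        · exact (measure_mono fun x hx => hx.1).trans h
        · simp only [h, and_false, ofPred_false, measure_empty, zero_le]
      refine ne_top_of_le_ne_top ?_ (ENNReal.tsum_le_tsum hb)
      rw [ENNReal.tsum_geometric]
      simp)
    exact this
  · choose f hf using hI x
    obtain ⟨i, hi⟩ := hz f
    refine ⟨i, hi.mono fun k hk => ?_⟩
    rw [hk]
    exact hf k

lemma exists_basis : ∃ I : ℕ → Set ℝ, (∀ i, IsOpen (I i)) ∧
    ∀ (U : Set ℝ), IsOpen U → ∀ x ∈ U, ∃ i, x ∈ I i ∧ I i ⊆ U := by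
  obtain ⟨b, hb1, hb2, hb3⟩ := TopologicalSpace.exists_countable_basis ℝ
  have hne : b.Nonempty := by
    obtain ⟨v, hv, _⟩ := hb3.exists_subset_of_mem_open (mem_univ (0:ℝ)) isOpen_univ
    exact ⟨v, hv⟩
  obtain ⟨I, rfl⟩ := hb1.exists_eq_range hne
  refine ⟨I, fun i => hb3.isOpen ⟨i, rfl⟩, fun U hU x hx => ?_⟩
  obtain ⟨v, ⟨i, rfl⟩, h1, h2⟩ := hb3.exists_subset_of_mem_open hx hU
  exact ⟨i, h1, h2⟩

lemma core [NullSingletonClass μ] {X0 : Set ℝ} (hX00 : μ X0 ≠ 0) {A0 : ℕ → Set ℝ}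
    (hH0 : DenseFam μ X0 A0) : False := by
  classical
  -- minimal ordinal
  let Good : Ordinal.{0} → Prop := fun o => ∃ (ρ : ℝ → Ordinal.{0}) (Y : Set ℝ), Y ⊆ X0 ∧ μ Y ≠ 0 ∧
    (∀ y ∈ Y, ρ y < o) ∧ ∀ β, μ {y ∈ Y | ρ y = β} = 0
  have hex : ∃ o, Good o := by
    refine ⟨Ordinal.type (WellOrderingRel : ℝ → ℝ → Prop),
      fun y => Ordinal.typein WellOrderingRel y, X0, subset_rfl, hX00,
      fun y _ => Ordinal.typein_lt_type _ y, fun β => ?_⟩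
    refine Set.Subsingleton.measure_zero ?_ μ
    rintro a ⟨_, ha⟩ b ⟨_, hb⟩
    exact Ordinal.typein_injective WellOrderingRel (ha.trans hb.symm)
  obtain ⟨κ, ⟨ρ, X, hXX0, hX0, hρκ, hfib⟩, hmin⟩ : ∃ κ, Good κ ∧ ∀ o < κ, ¬ Good o :=
    ⟨sInf {o | Good o}, csInf_mem (s := {o | Good o}) hex, fun o ho hg =>
      (csInf_le' (s := {o | Good o}) hg).not_gt ho⟩
  have hnull : ∀ α < κ, ∀ Y ⊆ X, ∀ ρ' : ℝ → Ordinal.{0}, (∀ y ∈ Y, ρ' y < α) →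
      (∀ β, μ {y ∈ Y | ρ' y = β} = 0) → μ Y = 0 := by
    intro α hα Y hY ρ' h1 h2
    by_contra h0
    exact hmin α hα ⟨ρ', Y, hY.trans hXX0, h0, h1, h2⟩
  -- restrict the family
  let A : ℕ → Set ℝ := fun n => A0 n ∩ X
  have hAX : ∀ m, A m ⊆ X := fun m => inter_subset_right
  have hH : DenseFam μ X A := by
    intro Y hY hY0
    obtain ⟨n, E, hE, h0, h1⟩ := hH0 Y (hY.trans hXX0) hY0
    refine ⟨n, E, hE, fun h => h0 ?_, measure_mono_null ?_ h1⟩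
    · refine measure_mono_null (t := (A n ∩ E) ∪ ((A0 n ∩ E) \ Y)) ?_ (measure_union_null h h1)
      intro x hx
      by_cases hxY : x ∈ Y
      · left; exact ⟨⟨hx.1, hY hxY⟩, hx.2⟩
      · right; exact ⟨hx, hxY⟩
    · rintro x ⟨⟨hx1, hx2⟩, hx3⟩
      exact ⟨⟨hx1.1, hx2⟩, hx3⟩
  have h_lower : ∀ β < κ, μ {y ∈ X | ρ y < β} = 0 := by
    intro β hβ
    refine hnull β hβ _ (fun y hy => hy.1) ρ (fun y hy => hy.2) fun γ => ?_
    refine measure_mono_null ?_ (hfib γ)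
    rintro y ⟨⟨hy1, _⟩, hy2⟩
    exact ⟨hy1, hy2⟩
  have hgt : ∀ x ∈ X, ∀ᵐ y ∂μ, y ∈ X → ρ x < ρ y := by
    intro x hx
    rw [ae_iff]
    refine measure_mono_null ?_ (measure_union_null (h_lower (ρ x) (hρκ x hx)) (hfib (ρ x)))
    intro y hy
    simp only [mem_ofPred_eq, Classical.not_imp, not_lt] at hy
    rcases hy.2.lt_or_eq with h | h
    · left; exact ⟨hy.1, h⟩
    · right; exact ⟨hy.1, h⟩
  obtain ⟨I, hIo, hIb⟩ := exists_basis
  have hε0 : μ X / 2 ≠ 0 := (ENNReal.half_pos hX0).ne'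
  have hε : μ X / 2 < μ X := ENNReal.half_lt_self hX0 (measure_ne_top _ _)
  have hOex : ∀ β : Ordinal.{0}, ∃ O : Set ℝ, IsOpen O ∧ μ O ≤ μ X / 2 ∧
      (β < κ → {y ∈ X | ρ y < β} ⊆ O) := by
    intro β
    by_cases hβ : β < κ
    · obtain ⟨O, h1, h2, h3⟩ := Set.exists_isOpen_lt_of_lt {y ∈ X | ρ y < β} (μ X / 2)
        (by rw [h_lower β hβ]; exact pos_iff_ne_zero.2 hε0)
      exact ⟨O, h2, h3.le, fun _ => h1⟩
    · exact ⟨∅, isOpen_empty, by simp, fun h => absurd h hβ⟩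
  choose O hOo hOμ hOs using hOex
  let S : Ordinal.{0} → ℕ → Bool := fun β i => decide (I i ⊆ O β)
  have hsplit : Splits μ X (fun y => S (ρ y)) := by
    intro Y hY
    refine lusin (X := X) (fun y => O (ρ y)) I (μ X / 2) hε (fun i => (hIo i).measurableSet)
      (fun y x hx => hIb _ (hOo _) x hx) (fun y => hOμ _) ?_ _ ?_ hY
    · intro x hx
      filter_upwards [hgt x hx] with y hy hyX
      exact hOs (ρ y) (hρκ y hyX) ⟨hx, hy hyX⟩
    · intro y i
      simp [S]
  obtain ⟨W, hW⟩ := exists_w hsplit A hAX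
  have hwild : Wild μ X (fun y => W (S (ρ y))) := wild_of hH hW
  obtain ⟨α, hα, hunb⟩ : ∃ α < κ, ∀ g : ℕ → ℕ, ∃ i : Iio α, ∃ᶠ k in atTop, g k < W (S i.1) k := by
    by_contra hc
    push Not at hc
    choose! g hg using hc
    obtain ⟨G, hG⟩ := dom_bound hH hX0 (fun y => g (ρ y))
    apply hX0
    refine measure_mono_null ?_ (wild_unbdd hwild G)
    intro x hx
    refine ⟨hx, hG _ ?_⟩
    filter_upwards [hgt x hx] with y hy hyX
    have := hg (ρ y) (hρκ y hyX) ⟨ρ x, hy hyX⟩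
    simpa using this
  obtain ⟨y0, hy0⟩ := evdiff hAX hH hX0 hwild (fun i : Iio α => W (S i.1)) hunb
  have hsmall : ∀ (x : ℝ) (k : ℕ), ∃ n, x ∈ I n ∧ μ (I n) ≤ (1/2 : ENNReal) ^ k := by
    intro x k
    obtain ⟨U, h1, h2, h3⟩ := Set.exists_isOpen_lt_of_lt {x} ((1/2 : ENNReal) ^ k) (μ := μ)
        (by rw [measure_singleton]; exact ENNReal.pow_pos (by simp) k)
    obtain ⟨n, hn1, hn2⟩ := hIb U h2 x (h1 rfl)
    exact ⟨n, hn1, (measure_mono hn2).trans h3.le⟩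
  obtain ⟨N, hN0, hN⟩ := null_cover I hsmall _ hy0
  choose r hr using hN
  apply hX0
  refine hnull α hα X subset_rfl (fun x => (r x).1) (fun x _ => (r x).2) fun β => ?_
  by_cases hβ : β < α
  · refine measure_mono_null ?_ (hN0 ⟨β, hβ⟩)
    rintro x ⟨_, hx⟩
    have : r x = ⟨β, hβ⟩ := Subtype.ext hx
    rw [← this]
    exact hr x
  · refine measure_mono_null (t := ∅) ?_ measure_empty
    rintro x ⟨_, hx⟩
    exact hβ (hx ▸ (r x).2)

/-- removing `Y` from `X` keeps every trace of the family full -/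
def Valid (μ : Measure ℝ) (A : ℕ → Set ℝ) (X Y : Set ℝ) : Prop :=
  ∀ m E, MeasurableSet E → μ (A m ∩ X ∩ E) ≠ 0 → μ ((A m ∩ X ∩ E) \ Y) ≠ 0

lemma key [NullSingletonClass μ] (A : ℕ → Set ℝ) {X : Set ℝ} (hX : μ X ≠ 0) :
    ∃ Y ⊆ X, μ Y ≠ 0 ∧ Valid μ A X Y := by
  by_contra hc
  push Not at hc
  refine core (μ := μ) (A0 := fun m => A m ∩ X) hX fun Y hY hY0 => ?_
  have := hc Y hY hY0
  unfold Valid at this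
  push Not at this
  obtain ⟨m, E, hE, h0, h1⟩ := this
  exact ⟨m, E, hE, h0, h1⟩

lemma glue (A : ℕ → Set ℝ) {X : Set ℝ} (Y : ℕ → Set ℝ) (hY : ∀ k, Y k ⊆ X)
    (hv : ∀ k, Valid μ A X (Y k)) :
    ∃ Z ⊆ X, Valid μ A X Z ∧ ∀ k, μ (Y k) ≤ μ Z := by
  let W : ℕ → Set ℝ := disjointed fun k => env μ (Y k)
  have hWm : ∀ k, MeasurableSet (W k) := fun k =>
    MeasurableSet.disjointed (fun k => env_meas (Y k)) k
  have hWd : ∀ {i j x}, x ∈ W i → x ∈ W j → i = j := by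
    intro i j x hi hj
    by_contra hne
    exact Set.disjoint_left.1 (disjoint_disjointed (fun k => env μ (Y k)) hne) hi hj
  have hWs : ∀ k, W k ⊆ env μ (Y k) := fun k => disjointed_subset _ k
  have hWU : ⋃ k, W k = ⋃ k, env μ (Y k) := iUnion_disjointed
  let Z : Set ℝ := ⋃ k, Y k ∩ W k
  refine ⟨Z, iUnion_subset fun k => inter_subset_left.trans (hY k), ?_, ?_⟩
  · intro m E hE h0
    by_cases h : ∃ k, μ (A m ∩ X ∩ (E ∩ W k)) ≠ 0
    · obtain ⟨k, hk⟩ := h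
      intro hz
      refine hv k m _ (hE.inter (hWm k)) hk (measure_mono_null ?_ hz)
      rintro x ⟨⟨hx1, hx2, hx3⟩, hx4⟩
      refine ⟨⟨hx1, hx2⟩, fun hxZ => ?_⟩
      obtain ⟨j, hj1, hj2⟩ := mem_iUnion.1 hxZ
      rw [hWd hj2 hx3] at hj1
      exact hx4 hj1
    · push Not at h
      intro hz
      apply h0
      refine measure_mono_null ?_ (measure_union_null hz (measure_iUnion_null h))
      rintro x ⟨hx1, hx2⟩
      by_cases hxZ : x ∈ Z
      · right
        obtain ⟨j, hj1, hj2⟩ := mem_iUnion.1 hxZ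
        exact mem_iUnion.2 ⟨j, hx1, hx2, hj2⟩
      · left; exact ⟨⟨hx1, hx2⟩, hxZ⟩
  · intro k
    have h1 : ∀ᵐ x ∂μ, ∀ i, x ∈ W i → x ∈ env μ (Y i) → x ∈ env μ Z := by
      rw [ae_all_iff]
      intro i
      refine env_mono_local (hWm i) ?_
      have hsub : Y i ∩ W i ⊆ Z := fun x hx => mem_iUnion.2 ⟨i, hx⟩
      rw [sdiff_eq_empty.2 hsub, measure_empty]
    rw [← measure_toMeasurable (Y k), ← measure_toMeasurable Z]
    refine measure_mono_ae ?_
    filter_upwards [h1] with x hx hxk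
    have : x ∈ ⋃ k, W k := by rw [hWU]; exact mem_iUnion.2 ⟨k, hxk⟩
    obtain ⟨i, hi⟩ := mem_iUnion.1 this
    exact hx i hi (hWs i hi)

lemma full [NullSingletonClass μ] (A : ℕ → Set ℝ) (X : Set ℝ) :
    ∃ Y ⊆ X, (∀ E, MeasurableSet E → μ (X ∩ E) ≠ 0 → μ (Y ∩ E) ≠ 0) ∧ Valid μ A X Y := by
  let C : Set ENNReal := {c | ∃ Y ⊆ X, Valid μ A X Y ∧ μ Y = c}
  have hCne : C.Nonempty := ⟨_, ∅, empty_subset _, fun m E _ h => by rwa [sdiff_empty], rfl⟩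
  obtain ⟨u, hu1, hu2, hu3⟩ := exists_seq_tendsto_sSup hCne (OrderTop.bddAbove C)
  choose Y hY1 hY2 hY3 using hu3
  obtain ⟨Z, hZX, hZv, hZ⟩ := glue A Y hY1 hY2
  have hmax : ∀ Y ⊆ X, Valid μ A X Y → μ Y ≤ μ Z := by
    intro Y' h1 h2
    refine (le_sSup (show μ Y' ∈ C from ⟨Y', h1, h2, rfl⟩)).trans ?_
    refine le_of_tendsto' hu2 fun k => ?_
    rw [← hY3]; exact hZ k
  refine ⟨Z, hZX, fun E hE hXE hZE => ?_, hZv⟩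
  let F : Set ℝ := E \ env μ Z
  have hFm : MeasurableSet F := hE.diff (env_meas _)
  have hXF : μ (X ∩ F) ≠ 0 := by
    intro h
    apply hXE
    refine measure_mono_null (t := (X ∩ F) ∪ (env μ Z ∩ E)) ?_
      (measure_union_null h (by rw [env_inter _ hE, hZE]))
    rintro x ⟨hx1, hx2⟩
    by_cases hx : x ∈ env μ Z
    · right; exact ⟨hx, hx2⟩
    · left; exact ⟨hx1, hx2, hx⟩
  obtain ⟨Y', hY'X, hY'0, hY'v⟩ := key A hXF
  have hv : Valid μ A X (Z ∪ Y') := by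
    intro m E' hE' h0 hz
    by_cases h : μ (A m ∩ (X ∩ F) ∩ E') = 0
    · refine hZv m (E' ∩ Fᶜ) (hE'.inter hFm.compl) (fun h2 => h0 ?_) (measure_mono_null ?_ hz)
      · refine measure_mono_null ?_ (measure_union_null h h2)
        rintro x ⟨⟨hx1, hx2⟩, hx3⟩
        by_cases hx : x ∈ F
        · left; exact ⟨⟨hx1, hx2, hx⟩, hx3⟩
        · right; exact ⟨⟨hx1, hx2⟩, hx3, hx⟩
      · rintro x ⟨⟨hx1, hx2, hx3⟩, hx4⟩
        exact ⟨⟨hx1, hx2⟩, fun hx => hx.elim hx4 fun h => hx3 (hY'X h).2⟩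
    · refine hY'v m E' hE' h (measure_mono_null ?_ hz)
      rintro x ⟨⟨⟨hx1, hx2, hx5⟩, hx3⟩, hx4⟩
      exact ⟨⟨⟨hx1, hx2⟩, hx3⟩, fun hx => hx.elim (fun h => hx5.2 (sub_env _ h)) hx4⟩
  have hle := hmax _ (union_subset hZX (hY'X.trans inter_subset_left)) hv
  have hadd := measure_inter_add_sdiff (μ := μ) (Z ∪ Y') (env_meas (μ := μ) Z)
  have h1 : μ Z ≤ μ ((Z ∪ Y') ∩ env μ Z) := measure_mono fun x hx => ⟨Or.inl hx, sub_env _ hx⟩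
  have h2 : μ Y' ≤ μ ((Z ∪ Y') \ env μ Z) :=
    measure_mono fun x hx => ⟨Or.inr hx, (hY'X hx).2.2⟩
  have h3 : μ Z + μ Y' ≤ μ Z + 0 := by
    rw [add_zero]
    exact ((add_le_add h1 h2).trans_eq hadd).trans hle
  have h4 := (ENNReal.add_le_add_iff_left (measure_ne_top μ Z)).1 h3
  exact hY'0 (le_antisymm h4 zero_le)

lemma disjoint_refine [NullSingletonClass μ] (A : ℕ → Set ℝ) :
    ∃ B : ℕ → Set ℝ, (∀ n, B n ⊆ A n) ∧ (∀ m n x, x ∈ B m → x ∈ B n → m = n) ∧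
      ∀ n E, MeasurableSet E → μ (A n ∩ E) ≠ 0 → μ (B n ∩ E) ≠ 0 := by
  have hstep := fun (n : ℕ) (U : Set ℝ) => full (μ := μ) A (A n \ U)
  choose Φ h1 h2 h3 using hstep
  let U : ℕ → Set ℝ := fun n => Nat.rec ∅ (fun n U => U ∪ Φ n U) n
  have hU : ∀ n, U (n+1) = U n ∪ Φ n (U n) := fun n => rfl
  have hinv : ∀ n m E, MeasurableSet E → μ (A m ∩ E) ≠ 0 → μ ((A m \ U n) ∩ E) ≠ 0 := by
    intro n
    induction n with
    | zero =>
      intro m E _ h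
      change μ ((A m \ ∅) ∩ E) ≠ 0
      rwa [sdiff_empty]
    | succ n ih =>
      intro m E hE h hz
      have h0 := ih m E hE h
      by_cases hc : μ (A m ∩ (A n \ U n) ∩ E) = 0
      · refine h0 (measure_mono_null ?_ (measure_union_null hc hz))
        rintro x ⟨⟨hx1, hx2⟩, hx3⟩
        by_cases hx : x ∈ A n
        · left; exact ⟨⟨hx1, hx, hx2⟩, hx3⟩
        · right
          refine ⟨⟨hx1, ?_⟩, hx3⟩
          rw [hU]
          exact fun h => h.elim hx2 fun h => hx (h1 _ _ h).1
      · refine h3 n (U n) m E hE hc (measure_mono_null ?_ hz)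
        rintro x ⟨⟨⟨hx1, hx2, hx5⟩, hx3⟩, hx4⟩
        refine ⟨⟨hx1, ?_⟩, hx3⟩
        rw [hU]
        exact fun h => h.elim hx5 hx4
  have hmono : Monotone U := monotone_nat_of_le_succ fun n => by rw [hU]; exact subset_union_left
  have hlt : ∀ m n x, m < n → x ∈ Φ m (U m) → x ∉ Φ n (U n) := by
    intro m n x hmn hm hn
    refine (h1 _ _ hn).2 (hmono (Nat.succ_le_of_lt hmn) ?_)
    change x ∈ U (m+1)
    rw [hU]
    exact Or.inr hm
  refine ⟨fun n => Φ n (U n), fun n => (h1 _ _).trans sdiff_subset, fun m n x hm hn => ?_,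
    fun n E hE h => h2 _ _ E hE (hinv n n E hE h)⟩
  rcases lt_trichotomy m n with h | h | h
  · exact absurd hn (hlt m n x h hm)
  · exact h
  · exact absurd hm (hlt n m x h hn)

lemma disjoint_refine_volume (A : ℕ → Set ℝ) :
    ∃ B : ℕ → Set ℝ, (∀ n, B n ⊆ A n) ∧ (∀ m n x, x ∈ B m → x ∈ B n → m = n) ∧
      ∀ n E, MeasurableSet E → volume (A n ∩ E) ≠ 0 → volume (B n ∩ E) ≠ 0 := by
  have h1 : ∀ S : Set ℝ, (volume : Measure ℝ).toFinite S = 0 ↔ volume S = 0 := fun S =>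
    ⟨fun h => absolutelyContinuous_toFinite _ h, fun h => toFinite_absolutelyContinuous _ h⟩
  have : NullSingletonClass (volume : Measure ℝ).toFinite :=
    ⟨fun x => (h1 _).2 (measure_singleton x)⟩
  obtain ⟨B, hB1, hB2, hB3⟩ := disjoint_refine (μ := (volume : Measure ℝ).toFinite) A
  refine ⟨B, hB1, hB2, fun n E hE h => ?_⟩
  rw [Ne, ← h1] at h ⊢
  exact hB3 n E hE h

lemma transversal : ∃ r : ℝ → ℝ, (∀ x, ∃ q : ℚ, x = r x + q) ∧
    ∀ x y, (∃ q : ℚ, r x - r y = q) → r x = r y := by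
  let H : AddSubgroup ℝ := (algebraMap ℚ ℝ).toAddMonoidHom.range
  let r : ℝ → ℝ := fun x => (QuotientAddGroup.mk x : ℝ ⧸ H).out
  have hr : ∀ x, (QuotientAddGroup.mk (r x) : ℝ ⧸ H) = QuotientAddGroup.mk x := fun x =>
    QuotientAddGroup.out_eq' _
  refine ⟨r, fun x => ?_, fun x y h => ?_⟩
  · obtain ⟨q, hq⟩ := QuotientAddGroup.eq.1 (hr x)
    refine ⟨q, ?_⟩
    have : (q : ℝ) = -r x + x := hq
    rw [this]; ring
  · obtain ⟨q, hq⟩ := h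
    have : (QuotientAddGroup.mk (r y) : ℝ ⧸ H) = QuotientAddGroup.mk (r x) := by
      refine QuotientAddGroup.eq.2 ⟨q, ?_⟩
      change (q : ℝ) = -r y + r x
      rw [← hq]; ring
    rw [hr, hr] at this
    change (QuotientAddGroup.mk x : ℝ ⧸ H).out = (QuotientAddGroup.mk y : ℝ ⧸ H).out
    rw [this]

end Refine

theorem stmt1 (A : Set ℝ) (hA : 0 < volume A) :
    ∃ B ⊆ A, ARD B ∧
      ∀ M : Set ℝ, MeasurableSet M → 0 < volume (M ∩ A) → 0 < volume (M ∩ B) := by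
  obtain ⟨r, hr1, hr2⟩ := Refine.transversal
  obtain ⟨q, hq⟩ := exists_surjective_nat ℚ
  obtain ⟨B, hB1, hB2, hB3⟩ := Refine.disjoint_refine_volume
    (fun n => {t | t ∈ Set.range r ∧ t + (q n : ℝ) ∈ A})
  refine ⟨{x | ∃ n, x - (q n : ℝ) ∈ B n}, ?_, ?_, ?_⟩
  · rintro x ⟨n, hn⟩
    have := (hB1 n hn).2
    rwa [sub_add_cancel] at this
  · rintro x ⟨n, hn⟩ y ⟨m, hm⟩ hxy hirr
    obtain ⟨c, hc⟩ := hirr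
    obtain ⟨⟨a, ha⟩, _⟩ := hB1 n hn
    obtain ⟨⟨b, hb⟩, _⟩ := hB1 m hm
    have hrat : ∃ c : ℚ, x - y = c := by
      rcases abs_choice (x - y) with h | h
      · exact ⟨c, by rw [hc, h]⟩
      · exact ⟨-c, by push_cast; rw [hc, h]; ring⟩
    obtain ⟨d, hd⟩ := hrat
    have heq : r a = r b := hr2 a b ⟨d - q n + q m, by
      rw [ha, hb]; push_cast; rw [← hd]; ring⟩
    rw [ha, hb] at heq
    have hnm : n = m := hB2 n m _ hn (heq ▸ hm)
    subst hnm
    exact hxy (by linarith)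
  · intro M hM hMA
    rw [pos_iff_ne_zero] at hMA ⊢
    have hex : ∃ n, volume {x | x ∈ M ∧ x - (q n : ℝ) ∈ {t | t ∈ Set.range r ∧ t + (q n : ℝ) ∈ A}} ≠ 0 := by
      by_contra hc
      push Not at hc
      apply hMA
      refine measure_mono_null ?_ (measure_iUnion_null hc)
      rintro x ⟨hxM, hxA⟩
      obtain ⟨p, hp⟩ := hr1 x
      obtain ⟨n, rfl⟩ := hq p
      refine Set.mem_iUnion.2 ⟨n, hxM, ⟨x, by linarith⟩, ?_⟩
      rwa [sub_add_cancel]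
    obtain ⟨n, hn⟩ := hex
    have hpre : ∀ S : Set ℝ, volume {x | x ∈ M ∧ x - (q n : ℝ) ∈ S}
        = volume (S ∩ (fun t => t + (q n : ℝ)) ⁻¹' M) := by
      intro S
      rw [← measure_preimage_add_right volume (-(q n : ℝ)) (S ∩ (fun t => t + (q n : ℝ)) ⁻¹' M)]
      congr 1
      ext x
      simp [sub_eq_add_neg, and_comm]
    rw [hpre] at hn
    have := hB3 n _ (measurable_add_const (q n : ℝ) hM) hn
    rw [← hpre] at this
    intro hz
    apply this
    refine measure_mono_null ?_ hz
    rintro x ⟨hx1, hx2⟩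
    exact ⟨hx1, n, hx2⟩
end

section
/- For every set E ⊆ ℝ that is nonmeager (of second category), there exists an ARD set F ⊆ E such that for every set B with the Baire property, if B ∩ E is nonmeager then B ∩ F is nonmeager. -/
open Topology

theorem aux_seq {s : Set ℝ} (hs : IsMeagre s) :
    ∃ O : ℕ → Set ℝ, (∀ k, IsOpen (O k)) ∧ (∀ k, Dense (O k)) ∧ ∀ y ∈ s, ∃ k, y ∉ O k := by
  obtain ⟨S, ho, hd, hc, hS⟩ := mem_residual_iff.1 hs
  obtain ⟨f, hf⟩ := (hc.insert Set.univ).exists_eq_range (Set.insert_nonempty _ _)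
  have hm : ∀ k, f k = Set.univ ∨ f k ∈ S := fun k => by
    have : f k ∈ insert Set.univ S := hf ▸ Set.mem_range_self k
    simpa using this
  refine ⟨f, fun k => ?_, fun k => ?_, fun y hy => ?_⟩
  · rcases hm k with h | h
    · rw [h]; exact isOpen_univ
    · exact ho _ h
  · rcases hm k with h | h
    · rw [h]; exact dense_univ
    · exact hd _ h
  · by_contra! hcon
    have : y ∈ ⋂₀ S := by
      intro t ht
      have : t ∈ Set.range f := hf ▸ Set.mem_insert_of_mem _ ht
      obtain ⟨k, rfl⟩ := this
      exact hcon k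
    exact hS this hy

theorem aux_dense {s : Set ℝ} (ho : IsOpen s) (hd : Dense s) : IsMeagre sᶜ := by
  unfold IsMeagre
  rw [compl_compl]
  exact residual_of_dense_open ho hd

theorem aux_basis (E U : Set ℝ) (hU : IsOpen U) (h : ¬ IsMeagre (U ∩ E)) :
    ∃ V ∈ TopologicalSpace.countableBasis ℝ, V ⊆ U ∧ ¬ IsMeagre (V ∩ E) := by
  by_contra! hcon
  apply h
  let S := {V : Set ℝ | V ∈ TopologicalSpace.countableBasis ℝ ∧ V ⊆ U}
  have hSc : S.Countable := (TopologicalSpace.countable_countableBasis ℝ).mono fun V hV => hV.1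
  have : Countable S := hSc.to_subtype
  have hm : IsMeagre (⋃ V : S, (V : Set ℝ) ∩ E) :=
    isMeagre_iUnion fun V => hcon V.1 V.2.1 V.2.2
  refine hm.mono ?_
  rintro x ⟨hxU, hxE⟩
  obtain ⟨V, hV, hxV, hVU⟩ :=
    (TopologicalSpace.isBasis_countableBasis ℝ).exists_subset_of_mem_open hxU hU
  exact Set.mem_iUnion.2 ⟨⟨V, hV, hVU⟩, hxV, hxE⟩

/-- Core step when `X` is well-ordered with `D 0`-meagre initial segments (inside `Y`). -/
theorem aux_core {X : Type*} [LinearOrder X] (π : ℝ → X)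
    (hπ : ∀ c, IsMeagre (π ⁻¹' {c})) (Y : Set X) (D : ℕ → Set ℝ) (A : Set ℝ)
    (hA0 : A ⊆ D 0) (hAY : A ⊆ π ⁻¹' Y) (hA : ¬ IsMeagre A)
    (hseg : ∀ c ∈ Y, IsMeagre (A ∩ π ⁻¹' {b | b < c}))
    (hD : ∀ n, ¬ IsMeagre (D n)) :
    ∃ Z : Set X, ¬ IsMeagre (D 0 ∩ π ⁻¹' Z) ∧ ∀ n, ¬ IsMeagre (D n \ π ⁻¹' Z) := by
  by_contra! hcon
  apply hA
  have hle : ∀ c : X, ∃ O : ℕ → Set ℝ, (∀ k, IsOpen (O k)) ∧ (∀ k, Dense (O k)) ∧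
      (c ∈ Y → ∀ y ∈ A, π y ≤ c → ∃ k, y ∉ O k) := by
    intro c
    by_cases hc : c ∈ Y
    · obtain ⟨O, h1, h2, h3⟩ := aux_seq ((hseg c hc).union (hπ c))
      refine ⟨O, h1, h2, fun _ y hy hyc => h3 y ?_⟩
      rcases hyc.lt_or_eq with h | h
      · exact Or.inl ⟨hy, h⟩
      · exact Or.inr h
    · exact ⟨fun _ => Set.univ, fun _ => isOpen_univ, fun _ => dense_univ, fun h => (hc h).elim⟩
  choose O hO hOd hOA using hle
  let 𝓑 := TopologicalSpace.countableBasis ℝ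
  -- sets of c such that V ⊆ O c k
  let H : ℕ → ℕ → Set ℝ := fun n k =>
    ⋃₀ {V | V ∈ 𝓑 ∧ ¬ IsMeagre (D n ∩ π ⁻¹' {c | V ⊆ O c k})}
  have hHo : ∀ n k, IsOpen (H n k) := fun n k =>
    isOpen_sUnion fun V hV => TopologicalSpace.isOpen_of_mem_countableBasis hV.1
  have hHd : ∀ n k, Dense (H n k) := by
    intro n k
    rw [dense_iff_inter_open]
    intro W hW hWne
    by_contra hne
    apply hD n
    have : Countable 𝓑 := (TopologicalSpace.countable_countableBasis ℝ).to_subtype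
    have hm : IsMeagre (⋃ V : {V : 𝓑 // (V : Set ℝ) ⊆ W ∧ (V : Set ℝ).Nonempty},
        D n ∩ π ⁻¹' {c | (V.1 : Set ℝ) ⊆ O c k}) := by
      refine isMeagre_iUnion fun V => ?_
      by_contra hV
      apply hne
      obtain ⟨z, hz⟩ := V.2.2
      exact ⟨z, V.2.1 hz, Set.mem_sUnion.2 ⟨V.1.1, ⟨V.1.2, hV⟩, hz⟩⟩
    refine hm.mono fun x hx => ?_
    obtain ⟨z, hzW, hzO⟩ := (hOd (π x) k).inter_open_nonempty W hW hWne
    obtain ⟨V, hV, hzV, hVs⟩ :=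
      (TopologicalSpace.isBasis_countableBasis ℝ).exists_subset_of_mem_open
        (show z ∈ W ∩ O (π x) k from ⟨hzW, hzO⟩) (hW.inter (hO _ k))
    exact Set.mem_iUnion.2 ⟨⟨⟨V, hV⟩, fun w hw => (hVs hw).1, ⟨z, hzV⟩⟩, hx,
      fun w hw => (hVs hw).2⟩
  have hbad : IsMeagre (⋃ p : ℕ × ℕ, (H p.1 p.2)ᶜ) :=
    isMeagre_iUnion fun p => aux_dense (hHo _ _) (hHd _ _)
  have key : ∀ y, (∀ n k, y ∈ H n k) → ∀ k, IsMeagre (D 0 ∩ π ⁻¹' {c | y ∉ O c k}) := by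
    intro y hy k
    by_contra hpos
    obtain ⟨n, hn⟩ := hcon _ hpos
    obtain ⟨V, ⟨hV, hVp⟩, hyV⟩ := Set.mem_sUnion.1 (hy n k)
    apply hVp
    refine hn.mono ?_
    rintro x ⟨hx, hxV⟩
    exact ⟨hx, fun h => h (hxV hyV)⟩
  by_contra hAm
  have : ∃ y ∈ A, ∀ n k, y ∈ H n k := by
    by_contra! hno
    apply hAm
    refine hbad.mono fun y hy => ?_
    obtain ⟨n, k, h⟩ := hno y hy
    exact Set.mem_iUnion.2 ⟨(n, k), h⟩
  obtain ⟨y, hyA, hy⟩ := this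
  apply hAm
  refine ((hseg (π y) (hAY hyA)).union (isMeagre_iUnion (key y hy))).mono fun x hx => ?_
  rcases lt_or_ge (π x) (π y) with h | h
  · exact Or.inl ⟨hx, h⟩
  · obtain ⟨k, hk⟩ := hOA (π x) (hAY hx) y hyA h
    exact Or.inr (Set.mem_iUnion.2 ⟨k, hA0 hx, hk⟩)

theorem aux_step {X : Type*} (π : ℝ → X)
    (hπ : ∀ c, IsMeagre (π ⁻¹' {c})) (D : ℕ → Set ℝ) (hD : ∀ n, ¬ IsMeagre (D n)) :
    ∃ Z : Set X, ¬ IsMeagre (D 0 ∩ π ⁻¹' Z) ∧ ∀ n, ¬ IsMeagre (D n \ π ⁻¹' Z) := by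
  classical
  let : LinearOrder X := linearOrderOfSTO WellOrderingRel
  have hwf : WellFounded (fun a b : X => a < b) := (inferInstance : IsWellFounded X WellOrderingRel).wf
  by_cases h : ∃ c, ¬ IsMeagre (D 0 ∩ π ⁻¹' {b | b < c})
  · let c := hwf.min {c | ¬ IsMeagre (D 0 ∩ π ⁻¹' {b | b < c})} h
    have hc : ¬ IsMeagre (D 0 ∩ π ⁻¹' {b | b < c}) := hwf.min_mem _ h
    refine aux_core π hπ {b | b < c} D (D 0 ∩ π ⁻¹' {b | b < c}) Set.inter_subset_left
      Set.inter_subset_right hc ?_ hD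
    intro a ha
    by_contra hn
    refine hwf.not_lt_min {c | ¬ IsMeagre (D 0 ∩ π ⁻¹' {b | b < c})} (x := a) ?_ ha
    intro hm
    refine hn (IsMeagre.mono ?_ hm)
    exact fun x hx => ⟨hx.1.1, hx.2⟩
  · push Not at h
    exact aux_core π hπ Set.univ D (D 0) subset_rfl (fun _ _ => trivial) (hD 0)
      (fun c _ => h c) hD

theorem aux_disj {X : Type*} (π : ℝ → X)
    (hπ : ∀ c, IsMeagre (π ⁻¹' {c})) (D : ℕ → Set ℝ) (hD : ∀ n, ¬ IsMeagre (D n)) :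
    ∃ G : ℕ → Set ℝ, (∀ n, G n ⊆ D n) ∧ (∀ n, ¬ IsMeagre (G n)) ∧
      ∀ i j, i < j → ∀ x ∈ G i, ∀ y ∈ G j, π x ≠ π y := by
  choose Z hZ1 hZ2 using aux_step π hπ
  let T := {D : ℕ → Set ℝ // ∀ n, ¬ IsMeagre (D n)}
  let next : T → T := fun d => ⟨fun n => d.1 (n + 1) \ π ⁻¹' (Z d.1 d.2),
    fun n => hZ2 d.1 d.2 (n + 1)⟩
  let d : ℕ → T := fun k => Nat.rec ⟨D, hD⟩ (fun _ t => next t) k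
  have hd : ∀ k n, (d (k + 1)).1 n = (d k).1 (n + 1) \ π ⁻¹' (Z (d k).1 (d k).2) :=
    fun k n => rfl
  have hsub : ∀ k n, (d k).1 n ⊆ D (n + k) := by
    intro k
    induction k with
    | zero => intro n; exact subset_rfl
    | succ k ih =>
      intro n x hx
      rw [hd] at hx
      have := ih (n + 1) hx.1
      rwa [show n + 1 + k = n + (k + 1) by ring] at this
  have hdis : ∀ i m n, ∀ x ∈ (d (i + 1 + m)).1 n, π x ∉ Z (d i).1 (d i).2 := by
    intro i m
    induction m with
    | zero => intro n x hx; rw [Nat.add_zero, hd] at hx; exact hx.2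
    | succ m ih =>
      intro n x hx
      rw [← Nat.add_assoc, hd] at hx
      exact ih (n + 1) x hx.1
  refine ⟨fun k => (d k).1 0 ∩ π ⁻¹' (Z (d k).1 (d k).2), fun n x hx => ?_,
    fun n => hZ1 _ _, fun i j hij x hx y hy hxy => ?_⟩
  · simpa using hsub n 0 hx.1
  · obtain ⟨m, rfl⟩ := Nat.exists_eq_add_of_le (Nat.succ_le_of_lt hij)
    exact hdis i m 0 y hy.1 (hxy ▸ hx.2)

theorem aux_sel {X : Type*} (π : ℝ → X) (hπ : ∀ c, (π ⁻¹' {c}).Countable) (G : Set ℝ)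
    (hG : ¬ IsMeagre G) : ∃ F ⊆ G, ¬ IsMeagre F ∧ Set.InjOn π F := by
  choose e he using fun c => Set.countable_iff_exists_injOn.1 (hπ c)
  by_contra! hcon
  apply hG
  have : IsMeagre (⋃ k : ℕ, {x ∈ G | e (π x) x = k}) := by
    refine isMeagre_iUnion fun k => ?_
    by_contra hk
    refine hcon _ (fun x hx => hx.1) hk ?_
    intro x hx y hy hxy
    refine he (π x) rfl hxy.symm ?_
    rw [hx.2, hxy, hy.2]
  refine this.mono fun x hx => Set.mem_iUnion.2 ⟨e (π x) x, ?_⟩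
  exact ⟨hx, rfl⟩

theorem aux_countable {s : Set ℝ} (hs : s.Countable) : IsMeagre s := by
  have : Countable s := hs.to_subtype
  have h : IsMeagre (⋃ x : s, {(x : ℝ)}) := isMeagre_iUnion fun x => by
    have := aux_dense (s := {(x : ℝ)}ᶜ) isOpen_compl_singleton (dense_compl_singleton _)
    rwa [compl_compl] at this
  exact h.mono fun x hx => Set.mem_iUnion.2 ⟨⟨x, hx⟩, rfl⟩

theorem stmt7 (E : Set ℝ) (hE : ¬ IsMeagre E) :
    ∃ F ⊆ E, ARD F ∧
      ∀ B : Set ℝ, BaireMeasurableSet B → ¬ IsMeagre (B ∩ E) → ¬ IsMeagre (B ∩ F) := by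
  let Q : AddSubgroup ℝ := (Rat.castHom ℝ).toAddMonoidHom.range
  let π : ℝ → ℝ ⧸ Q := fun x => (x : ℝ ⧸ Q)
  have hπ : ∀ x y, π x = π y ↔ ∃ q : ℚ, (q : ℝ) = -x + y := by
    intro x y
    exact QuotientAddGroup.eq
  have hπc : ∀ c, (π ⁻¹' {c}).Countable := by
    intro c
    obtain ⟨x, rfl⟩ := QuotientAddGroup.mk_surjective c
    refine (Set.countable_range (fun q : ℚ => x + (q : ℝ))).mono ?_
    intro y hy
    obtain ⟨q, hq⟩ := (hπ x y).1 (Eq.symm hy)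
    exact ⟨q, by simp [hq]⟩
  let S := {V | V ∈ TopologicalSpace.countableBasis ℝ ∧ ¬ IsMeagre (V ∩ E)}
  have hSc : S.Countable := (TopologicalSpace.countable_countableBasis ℝ).mono fun V hV => hV.1
  have hSne : S.Nonempty := by
    obtain ⟨V, h1, -, h2⟩ := aux_basis E Set.univ isOpen_univ (by simpa using hE)
    exact ⟨V, h1, h2⟩
  obtain ⟨V, hV⟩ := hSc.exists_eq_range hSne
  have hVS : ∀ n, V n ∈ S := fun n => hV ▸ Set.mem_range_self n
  obtain ⟨G, hGD, hGm, hGd⟩ := aux_disj π (fun c => aux_countable (hπc c))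
    (fun n => V n ∩ E) (fun n => (hVS n).2)
  choose F hFG hFm hFi using fun n => aux_sel π hπc (G n) (hGm n)
  refine ⟨⋃ n, F n, Set.iUnion_subset fun n x hx => (hGD n (hFG n hx)).2, ?_, ?_⟩
  · intro x hx y hy hxy
    rintro ⟨q, hq⟩
    have hxyπ : π x = π y := by
      rw [hπ]
      rcases abs_choice (x - y) with h | h
      · exact ⟨-q, by push_cast; linarith⟩
      · exact ⟨q, by linarith⟩
    obtain ⟨i, hi⟩ := Set.mem_iUnion.1 hx
    obtain ⟨j, hj⟩ := Set.mem_iUnion.1 hy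
    rcases lt_trichotomy i j with h | h | h
    · exact hGd i j h x (hFG i hi) y (hFG j hj) hxyπ
    · subst h
      exact hxy (hFi i hi hj hxyπ)
    · exact hGd j i h y (hFG j hj) x (hFG i hi) hxyπ.symm
  · intro B hB hBE hBF
    obtain ⟨U, hU, hBU⟩ := hB.residualEq_isOpen
    have hN : IsMeagre {x | ¬ (x ∈ B ↔ x ∈ U)} := by
      have h2 : {x | x ∈ B ↔ x ∈ U} ∈ residual ℝ :=
        Filter.mem_of_superset hBU fun x hx => Iff.of_eq hx
      unfold IsMeagre
      convert h2 using 1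
      ext x; simp
    have hUE : ¬ IsMeagre (U ∩ E) := by
      intro h
      apply hBE
      refine (h.union hN).mono ?_
      rintro x ⟨hxB, hxE⟩
      by_cases hxU : x ∈ U
      · exact Or.inl ⟨hxU, hxE⟩
      · exact Or.inr fun h => hxU (h.1 hxB)
    obtain ⟨W, hW, hWU, hWE⟩ := aux_basis E U hU hUE
    have : W ∈ Set.range V := hV ▸ (show W ∈ S from ⟨hW, hWE⟩)
    obtain ⟨n, rfl⟩ := this
    apply hFm n
    refine (hBF.union hN).mono fun x hx => ?_
    have hxU : x ∈ U := hWU (hGD n (hFG n hx)).1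
    by_cases hxB : x ∈ B
    · exact Or.inl ⟨hxB, Set.mem_iUnion.2 ⟨n, hx⟩⟩
    · exact Or.inr fun h => hxB (h.2 hxU)
end
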